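/- arXiv:2304.06450 — 5 statements merged into one kernel-verified Lean document; each statement's English description precedes it below -/
import Mathlib

section
/- Let K be a field of characteristic 0, let D be a Q-vector subspace of a K-vector space V, let F be a field of characteristic 0, and let exp : D → Fˣ be a group homomorphism. Define, for finite tuples/sets A over a set B ⊆ D with finite Q-linear dimension of A over B, the predimension δ(A/B) = ldim_K(A/B) + td(exp(A)/exp(B)) − ldim_Q(A/B). Then δ satisfies the addition formula: for X ⊆ Y ⊆ Z ⊆ D with appropriate finiteness, δ(Z/X) = δ(Z/Y) + δ(Y/X). -/
open Set Submodule

/-- Relative linear dimension: the dimension of the span of `A ∪ B` modulo the span of `B`. -/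
noncomputable def ldim (R : Type*) [DivisionRing R] {V : Type*} [AddCommGroup V] [Module R V]
    (A B : Set V) : ℕ :=
  Module.finrank R (↥(span R (A ∪ B)) ⧸ (span R B).comap (span R (A ∪ B)).subtype)

/-- Relative transcendence degree of `A` over (the field generated by) `B`. -/
noncomputable def td {F : Type*} [Field F] [CharZero F] (A B : Set F) : ℕ :=
  sSup {n : ℕ | ∃ s : Fin n → F, (∀ i, s i ∈ A) ∧
    AlgebraicIndependent (Algebra.adjoin ℚ B) s}

/-- A partial K-powered field: a ℚ-subspace `D` of a `K`-vector space `V` together with a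
partial exponential group homomorphism into `Fˣ`, such that `D` `K`-spans `V` and
`exp(D)` generates `F` as a field. -/
structure PPF (K : Type) [Field K] [CharZero K] where
  V : Type
  F : Type
  [addV : AddCommGroup V]
  [modK : Module K V]
  [modQ : Module ℚ V]
  [fieldF : Field F]
  [charF : CharZero F]
  D : Submodule ℚ V
  exp : V → F
  exp_ne_zero : ∀ x ∈ D, exp x ≠ 0
  exp_add : ∀ x ∈ D, ∀ y ∈ D, exp (x + y) = exp x * exp y
  spans : span K (D : Set V) = ⊤
  generates : Subfield.closure (exp '' D) = ⊤

attribute [instance] PPF.addV PPF.modK PPF.modQ PPF.fieldF PPF.charF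

variable {K : Type} [Field K] [CharZero K]

/-- The predimension δ(A/B) = ldim_K(A/B) + td(exp A / exp B) − ldim_ℚ(A/B). -/
noncomputable def PPF.delta (P : PPF K) (A B : Set P.V) : ℤ :=
  (ldim K A B : ℤ) + (td (P.exp '' A) (P.exp '' B) : ℤ) - (ldim ℚ A B : ℤ)

/-- A subset is strong in `P` if every finite tuple from the domain `D` has
nonnegative predimension over it. -/
def PPF.StrongIn (P : PPF K) (S : Set P.V) : Prop :=
  ∀ (n : ℕ) (z : Fin n → P.V), (∀ i, z i ∈ P.D) → 0 ≤ P.delta (Set.range z) S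

/-- A strong extension `D₀ ◁ D₁` of sub-partial-K-powered fields of `P`:
kernel-preserving, and every finite tuple from `D₁` has nonnegative predimension over `D₀`. -/
def PPF.StrongExt (P : PPF K) (D₀ D₁ : Submodule ℚ P.V) : Prop :=
  D₀ ≤ D₁ ∧ D₁ ≤ P.D ∧ (∀ x ∈ D₁, P.exp x = 1 → x ∈ D₀) ∧
    ∀ (n : ℕ) (z : Fin n → P.V), (∀ i, z i ∈ D₁) → 0 ≤ P.delta (Set.range z) (D₀ : Set P.V)

/-- The K-powers closure of `A` inside the sub-powered-field `E` of `P`. -/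
def PPF.pclIn (P : PPF K) (E : Submodule ℚ P.V) (A : Set P.V) : Submodule ℚ P.V :=
  sInf {S | A ⊆ S ∧ S ≤ E ∧ ∀ (n : ℕ) (z : Fin n → P.V), (∀ i, z i ∈ E) →
      P.delta (Set.range z) (S : Set P.V) ≤ 0 → ∀ i, z i ∈ S}

/-- Powers-transcendence degree of `A` over `B`, computed in the sub-powered-field `E` of `P`:
the least size of a tuple from `E` whose adjunction to `B` captures `A` in the closure. -/
noncomputable def PPF.ktdIn (P : PPF K) (E : Submodule ℚ P.V) (A B : Set P.V) : ℕ :=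
  sInf {m | ∃ s : Fin m → P.V, (∀ i, s i ∈ E) ∧ A ⊆ P.pclIn E (B ∪ Set.range s)}

/-- `S` is a purely powers-transcendental extension of `D₀` inside `P`: every finite tuple
from `S` not entirely contained in `D₀` has strictly positive predimension over `D₀`. -/
def PPF.PPT (P : PPF K) (D₀ S : Submodule ℚ P.V) : Prop :=
  D₀ ≤ S ∧ ∀ (n : ℕ) (z : Fin n → P.V), (∀ i, z i ∈ S) → (∃ i, z i ∉ D₀) →
    0 < P.delta (Set.range z) (D₀ : Set P.V)

/-- The subfield of `F` generated by the exponentials of `S`. -/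
def PPF.fieldOf (P : PPF K) (S : Submodule ℚ P.V) : Subfield P.F :=
  Subfield.closure (P.exp '' S)

/-- The sub-powered-field `S` of `P` is full: exp maps `S` onto the nonzero elements of its
field, and its field is (relatively) algebraically closed. -/
def PPF.FullSub (P : PPF K) (S : Submodule ℚ P.V) : Prop :=
  S ≤ P.D ∧ (∀ y ∈ P.fieldOf S, y ≠ 0 → ∃ x ∈ S, P.exp x = y) ∧
    ∀ y : P.F, (∃ p : Polynomial P.F, p ≠ 0 ∧ (∀ i, p.coeff i ∈ P.fieldOf S) ∧
      Polynomial.eval y p = 0) → y ∈ P.fieldOf S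

/-- `(eV, eF)` is an isomorphism, over the base `D₀`, between the sub-partial-K-powered fields
of `P` generated by `D₂` and `D₃`: `eV` is a `K`-linear bijection of the vector-space parts
mapping `D₂` onto `D₃` and fixing `D₀`, `eF` is a field isomorphism of the field parts fixing
the field of `D₀`, and the pair commutes with exp. -/
def PPF.IsIsoOver (P : PPF K) (D₂ D₃ D₀ : Submodule ℚ P.V)
    (eV : P.V → P.V) (eF : P.F → P.F) : Prop :=
  Set.BijOn eV (span K (D₂ : Set P.V) : Set P.V) (span K (D₃ : Set P.V)) ∧
  Set.BijOn eV (D₂ : Set P.V) (D₃ : Set P.V) ∧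
  (∀ x y : P.V, x ∈ span K (D₂ : Set P.V) → y ∈ span K (D₂ : Set P.V) →
    eV (x + y) = eV x + eV y) ∧
  (∀ (c : K) (x : P.V), x ∈ span K (D₂ : Set P.V) → eV (c • x) = c • eV x) ∧
  (∀ x ∈ D₀, eV x = x) ∧
  Set.BijOn eF (P.fieldOf D₂ : Set P.F) (P.fieldOf D₃ : Set P.F) ∧
  (∀ x y : P.F, x ∈ P.fieldOf D₂ → y ∈ P.fieldOf D₂ → eF (x + y) = eF x + eF y) ∧
  (∀ x y : P.F, x ∈ P.fieldOf D₂ → y ∈ P.fieldOf D₂ → eF (x * y) = eF x * eF y) ∧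
  (∀ x ∈ D₀, eF (P.exp x) = P.exp x) ∧
  (∀ x ∈ D₂, eF (P.exp x) = P.exp (eV x))

theorem ldim_eq_aux (R : Type*) [DivisionRing R] {V : Type*} [AddCommGroup V] [Module R V]
    (A B : Set V) (h : B ⊆ A) :
    ldim R A B = Module.finrank R ((span R A).map (span R B).mkQ) := by
  unfold ldim
  rw [Set.union_eq_self_of_subset_right h]
  have hk : (span R B).comap (span R A).subtype
      = LinearMap.ker ((span R B).mkQ ∘ₗ (span R A).subtype) := by
    rw [LinearMap.ker_comp, Submodule.ker_mkQ]
  have hr : (span R A).map (span R B).mkQ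
      = LinearMap.range ((span R B).mkQ ∘ₗ (span R A).subtype) := by
    rw [LinearMap.range_comp, Submodule.range_subtype]
  rw [hk, hr]
  exact LinearEquiv.finrank_eq (LinearMap.quotKerEquivRange _)

theorem ldim_add_aux (R : Type*) [DivisionRing R] {V : Type*} [AddCommGroup V] [Module R V]
    (X Y Z : Set V) (hXY : X ⊆ Y) (hYZ : Y ⊆ Z) (hfin : (Z \ X).Finite) :
    ldim R Z X = ldim R Z Y + ldim R Y X := by
  rw [ldim_eq_aux R Z X (hXY.trans hYZ), ldim_eq_aux R Z Y hYZ, ldim_eq_aux R Y X hXY]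
  have hpq : span R X ≤ span R Y := span_mono hXY
  have hqr : span R Y ≤ span R Z := span_mono hYZ
  have hfd : Module.Finite R ((span R Z).map (span R X).mkQ) := by
    have : (span R Z).map (span R X).mkQ = span R ((span R X).mkQ '' (Z \ X)) := by
      rw [Submodule.map_span]
      apply le_antisymm
      · rw [span_le]
        rintro _ ⟨z, hz, rfl⟩
        by_cases hx : z ∈ X
        · have : (span R X).mkQ z = 0 := by
            simpa using subset_span hx
          rw [this]; exact zero_mem _
        · exact subset_span ⟨z, ⟨hz, hx⟩, rfl⟩
      · exact span_mono (image_mono sdiff_subset)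
    rw [this]
    exact FiniteDimensional.span_of_finite R (hfin.image _)
  have h := LinearMap.finrank_range_add_finrank_ker
    ((Submodule.factor hpq) ∘ₗ ((span R Z).map (span R X).mkQ).subtype)
  rw [← h]
  congr 1
  · rw [LinearMap.range_comp, Submodule.range_subtype, ← Submodule.map_comp,
      Submodule.factor_comp_mk]
  · have hk : LinearMap.ker ((Submodule.factor hpq) ∘ₗ ((span R Z).map (span R X).mkQ).subtype)
      = ((span R Y).map (span R X).mkQ).comap ((span R Z).map (span R X).mkQ).subtype := by
      rw [LinearMap.ker_comp]
      congr 1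
      ext w
      obtain ⟨v, rfl⟩ := Submodule.mkQ_surjective _ w
      constructor
      · intro hv
        have : v ∈ span R Y := by simpa using hv
        exact ⟨v, this, rfl⟩
      · rintro ⟨u, hu, huv⟩
        rw [← huv]
        simpa using hu
    rw [hk]
    exact LinearEquiv.finrank_eq (Submodule.comapSubtypeEquivOfLe (Submodule.map_mono hqr))

theorem td_eq_aux {F : Type*} [Field F] [CharZero F] (A B : Set F) (h : B ⊆ A)
    (hfin : (A \ B).Finite)
    [Algebra (Algebra.adjoin ℚ B) (Algebra.adjoin ℚ A)]
    [IsScalarTower (Algebra.adjoin ℚ B) (Algebra.adjoin ℚ A) F] :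
    (td A B : Cardinal) = Algebra.trdeg (Algebra.adjoin ℚ B) (Algebra.adjoin ℚ A) := by
  have hinj : Function.Injective (algebraMap (Algebra.adjoin ℚ B) (Algebra.adjoin ℚ A)) := by
    have : Function.Injective (algebraMap (Algebra.adjoin ℚ B) F) := Subtype.val_injective
    rw [IsScalarTower.algebraMap_eq (Algebra.adjoin ℚ B) (Algebra.adjoin ℚ A) F, RingHom.coe_comp] at this
    exact Function.Injective.of_comp this
  have : FaithfulSMul (Algebra.adjoin ℚ B) (Algebra.adjoin ℚ A) := (faithfulSMul_iff_algebraMap_injective (Algebra.adjoin ℚ B) (Algebra.adjoin ℚ A)).2 hinj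
  let f : (Algebra.adjoin ℚ A) →ₐ[(Algebra.adjoin ℚ B)] F := IsScalarTower.toAlgHom (Algebra.adjoin ℚ B) (Algebra.adjoin ℚ A) F
  have hf : Function.Injective f := Subtype.val_injective
  let T : Set (Algebra.adjoin ℚ A) := Subtype.val ⁻¹' (A \ B)
  have hT : T.Finite := hfin.preimage Subtype.val_injective.injOn
  have htop : Algebra.adjoin (Algebra.adjoin ℚ B) T = ⊤ := by
    rw [eq_top_iff]
    rintro ⟨x, hx⟩ -
    have key : ∀ x (hx : x ∈ Algebra.adjoin ℚ A), (⟨x, hx⟩ : (Algebra.adjoin ℚ A)) ∈ Algebra.adjoin (Algebra.adjoin ℚ B) T := by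
      intro x hx
      induction hx using Algebra.adjoin_induction with
      | mem x hx =>
        by_cases hb : x ∈ B
        · have : (⟨x, Algebra.subset_adjoin hx⟩ : (Algebra.adjoin ℚ A))
              = algebraMap (Algebra.adjoin ℚ B) (Algebra.adjoin ℚ A) ⟨x, Algebra.subset_adjoin hb⟩ := by
            apply Subtype.val_injective
            exact (IsScalarTower.algebraMap_apply (Algebra.adjoin ℚ B) (Algebra.adjoin ℚ A) F ⟨x, Algebra.subset_adjoin hb⟩)
          rw [this]
          exact Subalgebra.algebraMap_mem _ _
        · exact Algebra.subset_adjoin ⟨hx, hb⟩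
      | algebraMap r =>
        have : (⟨algebraMap ℚ F r, Subalgebra.algebraMap_mem _ r⟩ : (Algebra.adjoin ℚ A))
              = algebraMap (Algebra.adjoin ℚ B) (Algebra.adjoin ℚ A) (algebraMap ℚ (Algebra.adjoin ℚ B) r) := by
            apply Subtype.val_injective
            exact (IsScalarTower.algebraMap_apply (Algebra.adjoin ℚ B) (Algebra.adjoin ℚ A) F (algebraMap ℚ (Algebra.adjoin ℚ B) r))
        rw [this]
        exact Subalgebra.algebraMap_mem _ _
      | add x y hx hy h1 h2 => exact add_mem h1 h2
      | mul x y hx hy h1 h2 => exact mul_mem h1 h2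
    exact key x hx
  have : Algebra.IsAlgebraic (Algebra.adjoin (Algebra.adjoin ℚ B) T) (Algebra.adjoin ℚ A) := by
    constructor
    intro x
    have hx : x ∈ Algebra.adjoin (Algebra.adjoin ℚ B) T := by rw [htop]; trivial
    exact isAlgebraic_algebraMap (A := Algebra.adjoin ℚ A) (⟨x, hx⟩ : Algebra.adjoin (Algebra.adjoin ℚ B) T)
  obtain ⟨t, htT, ht⟩ := exists_isTranscendenceBasis_subset (R := Algebra.adjoin ℚ B) T
  have htf : t.Finite := hT.subset htT
  have := htf.fintype
  have hcard : (Fintype.card t : Cardinal) = Algebra.trdeg (Algebra.adjoin ℚ B) (Algebra.adjoin ℚ A) := by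
    rw [← ht.cardinalMk_eq_trdeg, Cardinal.mk_fintype]
  rw [← hcard]
  congr 1
  have hg : IsGreatest {n : ℕ | ∃ s : Fin n → F, (∀ i, s i ∈ A) ∧ AlgebraicIndependent (Algebra.adjoin ℚ B) s}
      (Fintype.card t) := by
    constructor
    · refine ⟨fun i => f ((Fintype.equivFin t).symm i : t), fun i => ?_, ?_⟩
      · exact (htT ((Fintype.equivFin t).symm i).2).1
      · exact (ht.1.comp _ (Fintype.equivFin t).symm.injective).map' hf
    · rintro n ⟨s, hsA, hs⟩
      have h1 : AlgebraicIndependent (Algebra.adjoin ℚ B)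
          (fun i => (⟨s i, Algebra.subset_adjoin (hsA i)⟩ : (Algebra.adjoin ℚ A))) :=
        (f.algebraicIndependent_iff hf).1 hs
      have h2 := h1.lift_cardinalMk_le_trdeg
      rw [← hcard] at h2
      simpa using h2
  exact hg.csSup_eq

theorem td_add_aux {F : Type*} [Field F] [CharZero F] (X Y Z : Set F)
    (hXY : X ⊆ Y) (hYZ : Y ⊆ Z) (hfin : (Z \ X).Finite) :
    td Z X = td Z Y + td Y X := by
  let a1 : Algebra (Algebra.adjoin ℚ X) (Algebra.adjoin ℚ Y) :=
    (Subalgebra.inclusion (Algebra.adjoin_mono hXY)).toRingHom.toAlgebra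
  let a2 : Algebra (Algebra.adjoin ℚ Y) (Algebra.adjoin ℚ Z) :=
    (Subalgebra.inclusion (Algebra.adjoin_mono hYZ)).toRingHom.toAlgebra
  let a3 : Algebra (Algebra.adjoin ℚ X) (Algebra.adjoin ℚ Z) :=
    (Subalgebra.inclusion (Algebra.adjoin_mono (hXY.trans hYZ))).toRingHom.toAlgebra
  have : IsScalarTower (Algebra.adjoin ℚ X) (Algebra.adjoin ℚ Y) F :=
    IsScalarTower.of_algebraMap_eq fun _ => rfl
  have : IsScalarTower (Algebra.adjoin ℚ Y) (Algebra.adjoin ℚ Z) F :=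
    IsScalarTower.of_algebraMap_eq fun _ => rfl
  have : IsScalarTower (Algebra.adjoin ℚ X) (Algebra.adjoin ℚ Z) F :=
    IsScalarTower.of_algebraMap_eq fun _ => rfl
  have : IsScalarTower (Algebra.adjoin ℚ X) (Algebra.adjoin ℚ Y) (Algebra.adjoin ℚ Z) :=
    IsScalarTower.of_algebraMap_eq fun _ => rfl
  have : FaithfulSMul (Algebra.adjoin ℚ X) (Algebra.adjoin ℚ Y) :=
    (faithfulSMul_iff_algebraMap_injective _ _).2 (Subalgebra.inclusion_injective _)
  have : FaithfulSMul (Algebra.adjoin ℚ Y) (Algebra.adjoin ℚ Z) :=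
    (faithfulSMul_iff_algebraMap_injective _ _).2 (Subalgebra.inclusion_injective _)
  have h1 := td_eq_aux Z X (hXY.trans hYZ) hfin
  have h2 := td_eq_aux Z Y hYZ (hfin.subset (sdiff_subset_sdiff_right hXY))
  have h3 := td_eq_aux Y X hXY (hfin.subset (sdiff_subset_sdiff_left hYZ))
  have h4 := trdeg_add_eq (Algebra.adjoin ℚ X) (Algebra.adjoin ℚ Y)
    (A := Algebra.adjoin ℚ Z)
  rw [← h1, ← h2, ← h3] at h4
  have h5 : td Y X + td Z Y = td Z X := by exact_mod_cast h4
  omega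

/-- **Addition formula** for the predimension of a partial K-powered field:
for X ⊆ Y ⊆ Z ⊆ D with appropriate finiteness, δ(Z/X) = δ(Z/Y) + δ(Y/X). -/
theorem delta_addition_formula (P : PPF K) (X Y Z : Set P.V)
    (hXY : X ⊆ Y) (hYZ : Y ⊆ Z) (hZD : Z ⊆ (P.D : Set P.V))
    (hfin : (Z \ X).Finite) :
    P.delta Z X = P.delta Z Y + P.delta Y X := by
  have h1 := ldim_add_aux K X Y Z hXY hYZ hfin
  have h2 := ldim_add_aux ℚ X Y Z hXY hYZ hfin
  have h3 := td_add_aux (P.exp '' X) (P.exp '' Y) (P.exp '' Z) (image_mono hXY) (image_mono hYZ)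
    ((hfin.image P.exp).subset (subset_image_diff _ _ _))
  unfold PPF.delta
  rw [h1, h2, h3]
  push_cast
  ring
end

section
/- With the same setup of a partial K-powered field (D, V, exp, F) and predimension δ(A/B) = ldim_K(A/B) + td(exp(A)/exp(B)) − ldim_Q(A/B), δ is submodular: for subsets A₁, A₂ ⊆ D (with appropriate finiteness), δ(A₁ ∪ A₂ / A₁) ≤ δ(A₂ / ⟨A₁⟩_Q ∩ ⟨A₂⟩_Q). -/
open Set Submodule

variable {K : Type} [Field K] [CharZero K]

theorem ldim_add_aux_s1 (R : Type*) [DivisionRing R] {V : Type*} [AddCommGroup V] [Module R V]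
    (A B : Set V) (hA : A.Finite) :
    ldim R A B + Module.finrank R ((span R B).comap (span R A).subtype)
      = Module.finrank R (span R A) := by
  haveI : Module.Finite R (span R A) := FiniteDimensional.span_of_finite R hA
  set f := (span R B).mkQ.comp (span R (A ∪ B)).subtype with hf
  set g := (span R B).mkQ.comp (span R A).subtype with hg
  have hkf : LinearMap.ker f = (span R B).comap (span R (A ∪ B)).subtype := by
    rw [hf, LinearMap.ker_comp, ker_mkQ]
  have hkg : LinearMap.ker g = (span R B).comap (span R A).subtype := by
    rw [hg, LinearMap.ker_comp, ker_mkQ]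
  have hr : LinearMap.range f = LinearMap.range g := by
    rw [hf, hg, LinearMap.range_comp, LinearMap.range_comp, range_subtype, range_subtype,
      span_union, Submodule.map_sup, mkQ_map_self, sup_bot_eq]
  have h1 : ldim R A B = Module.finrank R (LinearMap.range g) := by
    rw [ldim, ← hkf, ← hr]
    exact f.quotKerEquivRange.finrank_eq
  rw [h1, ← hkg]
  exact g.finrank_range_add_finrank_ker

theorem ldim_union_aux (R : Type*) [DivisionRing R] {V : Type*} [AddCommGroup V] [Module R V]
    (A B : Set V) : ldim R (B ∪ A) B = ldim R A B := by
  have : B ∪ A ∪ B = A ∪ B := by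
    ext x; simp only [mem_union]; tauto
  unfold ldim
  rw [this]

theorem exp_zero_aux (P : PPF K) : P.exp 0 = 1 := by
  have h := P.exp_add 0 P.D.zero_mem 0 P.D.zero_mem
  rw [add_zero] at h
  exact (mul_eq_left₀ (P.exp_ne_zero 0 P.D.zero_mem)).1 h.symm

theorem exp_nsmul_aux (P : PPF K) (x : P.V) (hx : x ∈ P.D) (n : ℕ) :
    P.exp (n • x) = P.exp x ^ n := by
  induction n with
  | zero => simp [exp_zero_aux]
  | succ n ih => rw [succ_nsmul, P.exp_add _ (P.D.nsmul_mem hx n) _ hx, ih, pow_succ]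

theorem exp_neg_aux (P : PPF K) (x : P.V) (hx : x ∈ P.D) : P.exp (-x) = (P.exp x)⁻¹ := by
  have h := P.exp_add (-x) (P.D.neg_mem hx) x hx
  rw [neg_add_cancel, exp_zero_aux] at h
  exact eq_inv_of_mul_eq_one_left h.symm

theorem exp_alg_aux (P : PPF K) (A : Set P.V) (hA : A ⊆ (P.D : Set P.V)) (x : P.V)
    (hx : x ∈ span ℚ A) : IsAlgebraic (Algebra.adjoin ℚ (P.exp '' A)) (P.exp x) := by
  have hD : ∀ y ∈ span ℚ A, y ∈ P.D := fun y hy => span_le.2 hA hy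
  induction hx using span_induction with
  | mem x h =>
    exact isAlgebraic_algebraMap
      (⟨P.exp x, Algebra.subset_adjoin ⟨x, h, rfl⟩⟩ : Algebra.adjoin ℚ (P.exp '' A))
  | zero => rw [exp_zero_aux]; exact isAlgebraic_one
  | add x y hx hy h1 h2 => rw [P.exp_add x (hD x hx) y (hD y hy)]; exact h1.mul h2
  | smul q x hx h =>
    refine IsAlgebraic.of_pow q.den_pos ?_
    rw [← exp_nsmul_aux P _ (P.D.smul_mem q (hD x hx))]
    have e : q.den • q • x = q.num • x := by
      rw [← Nat.cast_smul_eq_nsmul ℚ, smul_smul, Rat.den_mul_eq_num, Int.cast_smul_eq_zsmul]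
    rw [e]
    obtain ⟨n, hn | hn⟩ := q.num.eq_nat_or_neg
    · rw [hn, natCast_zsmul, exp_nsmul_aux P x (hD x hx)]; exact h.pow n
    · rw [hn, neg_smul, natCast_zsmul, exp_neg_aux P _ (P.D.nsmul_mem (hD x hx) n),
        exp_nsmul_aux P x (hD x hx)]
      exact IsAlgebraic.inv_iff.2 (h.pow n)

theorem algInd_aux {F : Type*} [Field F] [CharZero F] (B C : Set F)
    (h : ∀ c ∈ C, IsAlgebraic (Algebra.adjoin ℚ B) c) {ι : Type*} (s : ι → F)
    (hs : AlgebraicIndependent (Algebra.adjoin ℚ B) s) :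
    AlgebraicIndependent (Algebra.adjoin ℚ C) s := by
  have h1 := hs.subalgebraAlgebraicClosure
  have hle : Algebra.adjoin ℚ C ≤
      (Subalgebra.algebraicClosure (Algebra.adjoin ℚ B) F).restrictScalars ℚ :=
    Algebra.adjoin_le h
  exact AlgebraicIndependent.of_ringHom_of_comp_eq
    (f := (Subalgebra.inclusion hle).toRingHom) (g := RingHom.id F) h1
    (Subalgebra.inclusion_injective hle) rfl

theorem td_aux {F : Type*} [Field F] [CharZero F] (A B C : Set F) (hA : A.Finite)
    (h : ∀ c ∈ C, IsAlgebraic (Algebra.adjoin ℚ B) c) : td (B ∪ A) B ≤ td A C := by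
  unfold td
  refine csSup_le_csSup ⟨hA.toFinset.card, ?_⟩ ⟨0, Fin.elim0, fun i => i.elim0, ?_⟩ ?_
  · rintro n ⟨s, hs, hi⟩
    have := Finset.card_le_card_of_injOn (s := Finset.univ) (t := hA.toFinset) s
      (fun i _ => by simpa using hs i) hi.injective.injOn
    simpa using this
  · rw [algebraicIndependent_empty_type_iff]
    exact Subtype.val_injective
  · rintro n ⟨s, hs, hi⟩
    refine ⟨s, fun i => (hs i).resolve_left fun hB => ?_, algInd_aux B C h s hi⟩
    exact hi.transcendental i (isAlgebraic_algebraMap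
      (⟨s i, Algebra.subset_adjoin hB⟩ : Algebra.adjoin ℚ B))

/-- **Submodularity** of the predimension of a partial K-powered field:
δ(A₁ ∪ A₂ / A₁) ≤ δ(A₂ / ⟨A₁⟩_ℚ ∩ ⟨A₂⟩_ℚ). -/
theorem delta_submodular (P : PPF K) (A₁ A₂ : Set P.V)
    (hA₁ : A₁ ⊆ (P.D : Set P.V)) (hA₂ : A₂ ⊆ (P.D : Set P.V)) (hfin : A₂.Finite) :
    P.delta (A₁ ∪ A₂) A₁ ≤ P.delta A₂ ((span ℚ A₁ ⊓ span ℚ A₂ : Submodule ℚ P.V) : Set P.V) := by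
  have hq := ldim_add_aux_s1 ℚ A₂ A₁ hfin
  have hq' := ldim_add_aux_s1 ℚ A₂ ((span ℚ A₁ ⊓ span ℚ A₂ : Submodule ℚ P.V) : Set P.V) hfin
  have hk := ldim_add_aux_s1 K A₂ A₁ hfin
  have hk' := ldim_add_aux_s1 K A₂ ((span ℚ A₁ ⊓ span ℚ A₂ : Submodule ℚ P.V) : Set P.V) hfin
  have ht := td_aux (P.exp '' A₂) (P.exp '' A₁)
    (P.exp '' ((span ℚ A₁ ⊓ span ℚ A₂ : Submodule ℚ P.V) : Set P.V)) (hfin.image _) (by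
      rintro _ ⟨x, hx, rfl⟩
      exact exp_alg_aux P A₁ hA₁ x hx.1)
  have e : (span ℚ A₁ ⊓ span ℚ A₂).comap (span ℚ A₂).subtype
      = (span ℚ A₁).comap (span ℚ A₂).subtype := by
    ext x; simp
  rw [span_eq, e] at hq'
  have hle : span K ((span ℚ A₁ ⊓ span ℚ A₂ : Submodule ℚ P.V) : Set P.V) ≤ span K A₁ := by
    rw [span_le]
    intro x hx
    have hx1 : x ∈ span ℚ A₁ := hx.1
    letI : Algebra ℚ K := DivisionRing.toRatAlgebra
    haveI : IsScalarTower ℚ K P.V := IsScalarTower.rat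
    exact span_le_restrictScalars ℚ K A₁ hx1
  haveI : Module.Finite K (span K A₂) := FiniteDimensional.span_of_finite K hfin
  have hm := Submodule.finrank_mono (Submodule.comap_mono (f := (span K A₂).subtype) hle)
  unfold PPF.delta
  rw [ldim_union_aux, ldim_union_aux, image_union]
  omega
end

section
/- Let D be a partial K-powered field with predimension δ, and say a Q-subspace D₁ ⊆ D is strong in D (written D₁ ◁ D) if δ(z/D₁) ≥ 0 for every finite tuple z from D. If J is any index set and for each j ∈ J the subspace D_j is strong in D, then the intersection ⋂_{j∈J} D_j is strong in D. -/
open Set Submodule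

variable {K : Type} [Field K] [CharZero K]

lemma td_bdd {F : Type*} [Field F] [CharZero F] {A : Set F} (B : Set F) (hA : A.Finite) :
    BddAbove {n : ℕ | ∃ s : Fin n → F, (∀ i, s i ∈ A) ∧
      AlgebraicIndependent (Algebra.adjoin ℚ B) s} := by
  refine ⟨A.ncard, ?_⟩
  rintro n ⟨s, hs, hi⟩
  have h1 : (range s).ncard = n := by
    rw [← image_univ, ncard_image_of_injective _ hi.injective, ncard_univ, Nat.card_fin]
  rw [← h1]
  exact ncard_le_ncard (range_subset_iff.mpr hs) hA

lemma td_mem {F : Type*} [Field F] [CharZero F] {A : Set F} (B : Set F) (hA : A.Finite) :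
    ∃ s : Fin (td A B) → F, (∀ i, s i ∈ A) ∧ AlgebraicIndependent (Algebra.adjoin ℚ B) s := by
  have := Nat.sSup_mem (s := {n : ℕ | ∃ s : Fin n → F, (∀ i, s i ∈ A) ∧
      AlgebraicIndependent (Algebra.adjoin ℚ B) s}) ⟨0, Fin.elim0, fun i => i.elim0, ?_⟩
      (td_bdd B hA)
  · exact this
  · rw [algebraicIndependent_empty_type_iff]
    exact FaithfulSMul.algebraMap_injective _ _

lemma td_add {F : Type*} [Field F] [CharZero F] {A A' B B' : Set F} (hA : A.Finite)
    (hA' : A'.Finite) (hB : B ⊆ B') (hAB : A' ⊆ B')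
    (halg : ∀ a ∈ A', IsAlgebraic (Algebra.adjoin (Algebra.adjoin ℚ B) A) a) :
    td A B' + td A' B ≤ td A B := by
  obtain ⟨s, hs, hsi⟩ := td_mem B' hA
  obtain ⟨t, ht, hti⟩ := td_mem B hA'
  let R := Algebra.adjoin ℚ B
  let S := Algebra.adjoin ℚ B'
  have hRS : R ≤ S := Algebra.adjoin_mono hB
  let _ : Algebra R S := (Subalgebra.inclusion hRS).toAlgebra
  have : IsScalarTower R S F := .of_algebraMap_eq fun x ↦ rfl
  have hsum : AlgebraicIndependent R (Sum.elim s t) := by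
    refine AlgebraicIndependent.sumElim_of_tower (S := S) hti ?_ hsi
    rintro _ ⟨i, rfl⟩
    exact ⟨⟨t i, Algebra.subset_adjoin (hAB (ht i))⟩, rfl⟩
  let M := AlgebraicIndependent.matroid R F
  have hind : M.Indep (range (Sum.elim s t)) := hsum.to_subtype_range
  have hsub : range (Sum.elim s t) ⊆ M.closure A := by
    rw [AlgebraicIndependent.matroid_closure_eq]
    rintro _ ⟨i | i, rfl⟩
    · exact isAlgebraic_algebraMap
        (⟨s i, Algebra.subset_adjoin (hs i)⟩ : Algebra.adjoin R A)
    · exact halg _ (ht i)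
  obtain ⟨I, hI⟩ := M.exists_isBasis A (subset_univ _)
  have hle : (range (Sum.elim s t)).encard ≤ I.encard := by
    have := hind.encard_le_eRk_of_subset hsub
    rwa [M.eRk_closure_eq, hI.eRk_eq_encard] at this
  have hIfin : I.Finite := hA.subset hI.subset
  have hcard : (range (Sum.elim s t)).ncard = td A B' + td A' B := by
    rw [← image_univ, ncard_image_of_injective _ hsum.injective, ncard_univ]
    simp
  have hle2 : td A B' + td A' B ≤ I.ncard := by
    rw [← hcard, ncard, ncard]
    exact ENat.toNat_le_toNat hle hIfin.encard_lt_top.ne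
  refine hle2.trans (le_csSup (td_bdd B hA) ?_)
  have e : Fin I.ncard ≃ I := by
    have := hIfin.to_subtype
    exact (Finite.equivFinOfCardEq rfl).symm
  have hIi : AlgebraicIndependent R ((↑) : I → F) := hI.indep
  exact ⟨fun i => e i, fun i => hI.subset (e i).2, hIi.comp e e.injective⟩

lemma ldim_add {R : Type*} [DivisionRing R] {V : Type*} [AddCommGroup V] [Module R V]
    {A : Set V} (B : Set V) (hA : A.Finite) :
    ldim R A B + Module.finrank R ↥(span R A ⊓ span R B) = Module.finrank R (span R A) := by
  have := FiniteDimensional.span_of_finite R hA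
  have e := LinearMap.quotientInfEquivSupQuotient (span R A) (span R B)
  have h := e.finrank_eq
  have h2 : ldim R A B = Module.finrank R
      (↥(span R A ⊔ span R B) ⧸ (span R B).comap (span R A ⊔ span R B).subtype) := by
    unfold ldim
    rw [span_union]
  rw [h2, ← h]
  have h3 := Submodule.finrank_quotient_add_finrank
    ((span R A ⊓ span R B).comap (span R A).subtype)
  have h4 : Module.finrank R ((span R A ⊓ span R B).comap (span R A).subtype)
      = Module.finrank R ↥(span R A ⊓ span R B) :=
    (Submodule.comapSubtypeEquivOfLe inf_le_left).finrank_eq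
  rw [h4] at h3
  exact h3

lemma exp_alg (P : PPF K) {A : Set P.V} (hA : A ⊆ P.D) {R : Type*} [CommRing R] [IsDomain R]
    [Algebra R P.F]
    (h : ∀ a ∈ A, IsAlgebraic R (P.exp a)) {v : P.V} (hv : v ∈ span ℚ A) :
    IsAlgebraic R (P.exp v) := by
  have h0 : P.exp 0 = 1 := by
    have := P.exp_add 0 P.D.zero_mem 0 P.D.zero_mem
    rw [add_zero] at this
    exact (mul_eq_left₀ (P.exp_ne_zero 0 P.D.zero_mem)).mp this.symm
  have hn : ∀ x ∈ P.D, ∀ n : ℕ, P.exp (n • x) = P.exp x ^ n := by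
    intro x hx n
    induction n with
    | zero => simp [h0]
    | succ k ih =>
      rw [succ_nsmul, P.exp_add _ (P.D.nsmul_mem hx k) _ hx, ih, pow_succ]
  have hneg : ∀ x ∈ P.D, P.exp (-x) = (P.exp x)⁻¹ := by
    intro x hx
    apply eq_inv_of_mul_eq_one_left
    rw [← P.exp_add _ (P.D.neg_mem hx) _ hx, neg_add_cancel, h0]
  have hz : ∀ x ∈ P.D, ∀ n : ℤ, P.exp (n • x) = P.exp x ^ n := by
    intro x hx n
    obtain ⟨m, rfl | rfl⟩ := n.eq_nat_or_neg
    · simp [hn x hx]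
    · rw [neg_smul, hneg _ (zsmul_mem hx _)]
      simp [hn x hx]
  have hD : span ℚ A ≤ P.D := span_le.mpr hA
  induction hv using span_induction with
  | mem x hx => exact h x hx
  | zero => rw [h0]; exact isAlgebraic_one
  | add x y hx hy ihx ihy => rw [P.exp_add x (hD hx) y (hD hy)]; exact ihx.mul ihy
  | smul q x hx ih =>
    have hx := hD hx
    refine IsAlgebraic.of_pow (n := q.den) q.den_pos ?_
    rw [← hn _ (P.D.smul_mem q hx)]
    have : q.den • (q • x) = q.num • x := by
      rw [← Nat.cast_smul_eq_nsmul ℚ, ← Int.cast_smul_eq_zsmul ℚ, smul_smul, mul_comm,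
        Rat.mul_den_eq_num]
    rw [this, hz x hx]
    obtain ⟨m, hm | hm⟩ := q.num.eq_nat_or_neg
    · rw [hm, zpow_natCast]; exact ih.pow m
    · rw [hm, zpow_neg, zpow_natCast]; exact (ih.pow m).inv

/-- The intersection of any family of strong ℚ-subspaces of a partial K-powered field
is strong. -/
theorem strong_iInter (P : PPF K) {J : Type} [Nonempty J] (Dj : J → Submodule ℚ P.V)
    (hsub : ∀ j, Dj j ≤ P.D) (hstrong : ∀ j, P.StrongIn ((Dj j : Set P.V))) :
    (⨅ j, Dj j) ≤ P.D ∧ P.StrongIn (((⨅ j, Dj j : Submodule ℚ P.V) : Set P.V)) := by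
  have hI : (⨅ j, Dj j) ≤ P.D := (iInf_le Dj (Classical.arbitrary J)).trans (hsub _)
  refine ⟨hI, ?_⟩
  suffices H : ∀ (m n : ℕ) (z : Fin n → P.V), (∀ i, z i ∈ P.D) →
      Module.finrank ℚ (span ℚ (range z)) = m →
      0 ≤ P.delta (range z) (((⨅ j, Dj j : Submodule ℚ P.V) : Set P.V)) from
    fun n z hz => H _ n z hz rfl
  intro m
  induction m using Nat.strong_induction_on with
  | _ m ih =>
  intro n z hz hm
  set I : Submodule ℚ P.V := ⨅ j, Dj j with hIdef
  set W := span ℚ (range z) with hW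
  have hfW : FiniteDimensional ℚ W := FiniteDimensional.span_of_finite ℚ (finite_range z)
  have hzD : range z ⊆ P.D := range_subset_iff.mpr hz
  by_cases hall : ∀ j, W ≤ Dj j
  · have hWI : W ≤ I := le_iInf hall
    have h0 := ldim_add (R := ℚ) (I : Set P.V) (finite_range z)
    rw [← hW, span_eq, inf_eq_left.mpr hWI] at h0
    have h1 : ldim ℚ (range z) (I : Set P.V) = 0 := by omega
    unfold PPF.delta
    rw [h1]
    omega
  push Not at hall
  obtain ⟨j, hj⟩ := hall
  set S := Dj j with hS
  have hIS : I ≤ S := iInf_le Dj j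
  have hlt : W ⊓ S < W := lt_of_le_of_ne inf_le_left fun h => hj (inf_eq_left.mp h)
  have hfY : FiniteDimensional ℚ ↥(W ⊓ S) := Submodule.finiteDimensional_inf_left W S
  obtain ⟨k, y, hy⟩ := Submodule.fg_iff_exists_fin_generating_family.mp
    ((Submodule.fg_iff_finiteDimensional (W ⊓ S)).mpr hfY)
  have hyWS : ∀ i, y i ∈ W ⊓ S := fun i => hy ▸ subset_span (mem_range_self i)
  have hyD : ∀ i, y i ∈ P.D := fun i => hsub j (hyWS i).2
  have h1 := ih _ (hm ▸ Submodule.finrank_lt_finrank_of_lt hlt) k y hyD (by rw [hy])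
  have h2 := hstrong j n z hz
  rw [← hS] at h2
  -- rational dimensions
  have q1 := ldim_add (R := ℚ) (I : Set P.V) (finite_range z)
  have q2 := ldim_add (R := ℚ) (S : Set P.V) (finite_range z)
  have q3 := ldim_add (R := ℚ) (I : Set P.V) (finite_range y)
  rw [span_eq, ← hW] at q1 q2
  rw [span_eq, hy, inf_assoc, inf_eq_right.mpr hIS] at q3
  -- `K`-dimensions
  have k1 := ldim_add (R := K) (I : Set P.V) (finite_range z)
  have k2 := ldim_add (R := K) (S : Set P.V) (finite_range z)
  have k3 := ldim_add (R := K) (I : Set P.V) (finite_range y)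
  have hyz : span K (range y) ≤ span K (range z) := by
    rw [span_le]
    rintro _ ⟨i, rfl⟩
    have := (hyWS i).1
    exact span_subset_span ℚ K _ this
  have hyS : span K (range y) ≤ span K (S : Set P.V) :=
    span_mono (range_subset_iff.mpr fun i => (hyWS i).2)
  have hISK : span K (I : Set P.V) ≤ span K (S : Set P.V) := span_mono hIS
  have hfz : FiniteDimensional K (span K (range z)) :=
    FiniteDimensional.span_of_finite K (finite_range z)
  have hfy : FiniteDimensional K (span K (range y)) :=
    FiniteDimensional.span_of_finite K (finite_range y)
  have hf1 := Submodule.finiteDimensional_inf_left (span K (range z)) (span K (I : Set P.V))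
  have hf2 := Submodule.finiteDimensional_inf_left (span K (range z)) (span K (S : Set P.V))
  have k4 := Submodule.finrank_sup_add_finrank_inf_eq (span K (range y))
    (span K (range z) ⊓ span K (I : Set P.V))
  rw [← inf_assoc, inf_eq_left.mpr hyz] at k4
  have k5 : Module.finrank K ↥(span K (range y) ⊔ span K (range z) ⊓ span K (I : Set P.V)) ≤
      Module.finrank K ↥(span K (range z) ⊓ span K (S : Set P.V)) :=
    Submodule.finrank_mono (sup_le (le_inf hyz hyS) (inf_le_inf_left _ hISK))
  -- transcendence degrees
  have t1 : td (P.exp '' range z) (P.exp '' S) + td (P.exp '' range y) (P.exp '' I) ≤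
      td (P.exp '' range z) (P.exp '' I) := by
    refine td_add ((finite_range z).image _) ((finite_range y).image _) (image_mono hIS)
      (image_mono (range_subset_iff.mpr fun i => (hyWS i).2)) ?_
    rintro _ ⟨_, ⟨i, rfl⟩, rfl⟩
    refine exp_alg P hzD ?_ (hyWS i).1
    intro a ha
    exact isAlgebraic_algebraMap (⟨P.exp a, Algebra.subset_adjoin (mem_image_of_mem _ ha)⟩ :
      Algebra.adjoin (Algebra.adjoin ℚ (P.exp '' (I : Set P.V))) (P.exp '' range z))
  unfold PPF.delta at *
  omega
end

section
/- Let F be an exponential field satisfying the Schanuel property (δ^exp(A) ≥ 0 for all finite A), and let K ⊆ F be a subfield of finite transcendence degree d. Then for every finite tuple z in F, δ^K(z) ≥ −d, where δ^K(z) = ldim_K(z) + td(exp(z)) − ldim_Q(z). Consequently there is a finite tuple a achieving the minimal value of δ^K, and ⟨a⟩_Q is a finitely generated strong partial K-powered subfield of F regarded as a K-powered field. -/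
open Set Submodule

variable {K : Type} [Field K] [CharZero K]

theorem fs_ldim_add {R V : Type*} [DivisionRing R] [AddCommGroup V] [Module R V]
    (A B : Set V) [FiniteDimensional R (span R (A ∪ B))] :
    ldim R A B + Module.finrank R (span R B) = Module.finrank R (span R (A ∪ B)) := by
  unfold ldim
  rw [← Submodule.finrank_quotient_add_finrank
    ((span R B).comap (span R (A ∪ B)).subtype)]
  congr 1
  exact (Submodule.comapSubtypeEquivOfLe (span_mono subset_union_right)).finrank_eq.symm

theorem fs_ldim_empty {R V : Type*} [DivisionRing R] [AddCommGroup V] [Module R V]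
    (A : Set V) (hA : A.Finite) : ldim R A ∅ = Module.finrank R (span R A) := by
  have : FiniteDimensional R (span R (A ∪ ∅)) := by
    rw [union_empty]; exact FiniteDimensional.span_of_finite R hA
  have h := fs_ldim_add (R := R) A ∅
  rw [span_empty, finrank_bot, union_empty] at h
  simpa using h

/-- The algebraic matroid over ℚ. -/
noncomputable abbrev fsM (F : Type*) [Field F] [CharZero F] : Matroid F :=
  AlgebraicIndependent.matroid ℚ F

theorem fs_bdd {F : Type*} [Field F] [CharZero F] (A B : Set F) (hA : A.Finite) :
    BddAbove {n : ℕ | ∃ s : Fin n → F, (∀ i, s i ∈ A) ∧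
      AlgebraicIndependent (Algebra.adjoin ℚ B) s} := by
  refine ⟨A.ncard, ?_⟩
  rintro n ⟨s, hs, hi⟩
  have h1 : (range s).ncard = n := by
    rw [← image_univ, ncard_image_of_injective _ hi.injective]; simp
  rw [← h1]
  exact ncard_le_ncard (range_subset_iff.2 hs) hA

theorem fs_mem_closure {F : Type*} [Field F] [CharZero F] (A : Set F) (x : F) :
    x ∈ (fsM F).closure A ↔ IsAlgebraic (Algebra.adjoin ℚ A) x := by
  rw [fsM, AlgebraicIndependent.matroid_closure_eq]
  rfl

theorem fs_rk_le {F : Type*} [Field F] [CharZero F] (A B : Set F) (hA : A.Finite) :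
    (fsM F).eRk (A ∪ B) ≤ (td A B : ℕ∞) + (fsM F).eRk B := by
  obtain ⟨s, hs⟩ := (AlgebraicIndependent.matroid (Algebra.adjoin ℚ B) F).exists_isBasis A
    (subset_univ _)
  rw [AlgebraicIndependent.matroid_isBasis_iff] at hs
  obtain ⟨hind, hsA, halg⟩ := hs
  have hsf : s.Finite := hA.subset hsA
  have hcard : s.ncard ≤ td A B := by
    refine le_csSup (fs_bdd A B hA) ?_
    have := hsf.to_subtype
    let e : Fin s.ncard ≃ s := (Finite.equivFinOfCardEq (α := s) rfl).symm
    refine ⟨fun i => (e i : F), fun i => hsA (e i).2, ?_⟩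
    exact AlgebraicIndependent.comp hind e e.injective
  have hsub : A ∪ B ⊆ (fsM F).closure (B ∪ s) := by
    refine union_subset ?_ ?_
    · intro x hx
      rw [fs_mem_closure]
      have h := halg x hx
      rw [Algebra.adjoin_union_eq_adjoin_adjoin]
      exact h
    · exact subset_union_left.trans ((fsM F).subset_closure _ (subset_univ _))
  calc (fsM F).eRk (A ∪ B) ≤ (fsM F).eRk ((fsM F).closure (B ∪ s)) := (fsM F).eRk_mono hsub
    _ = (fsM F).eRk (B ∪ s) := (fsM F).eRk_closure_eq _
    _ ≤ (fsM F).eRk B + s.encard := (fsM F).eRk_union_le_eRk_add_encard _ _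
    _ ≤ _ := by
      rw [add_comm, ← hsf.cast_ncard_eq]
      gcongr

theorem fs_td_le {F : Type*} [Field F] [CharZero F] (A : Set F) (hA : A.Finite) :
    (td A ∅ : ℕ∞) ≤ (fsM F).eRk A := by
  have hmem := Nat.sSup_mem (s := {n : ℕ | ∃ s : Fin n → F, (∀ i, s i ∈ A) ∧
      AlgebraicIndependent (Algebra.adjoin ℚ (∅ : Set F)) s})
      ⟨0, Fin.elim0, fun i => i.elim0, by
        rw [algebraicIndependent_empty_type_iff]
        exact Subtype.val_injective⟩ (fs_bdd A ∅ hA)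
  change td A ∅ ∈ _ at hmem
  obtain ⟨s, hs, hi⟩ := hmem
  have hi' : AlgebraicIndependent ℚ s := hi.restrictScalars
    (RingHom.injective (algebraMap ℚ (Algebra.adjoin ℚ (∅ : Set F))))
  have hI : (fsM F).Indep (range s) := by
    rw [AlgebraicIndependent.matroid_indep_iff]
    exact hi'.to_subtype_range
  have h1 : (range s).encard = (td A ∅ : ℕ) := by
    rw [← image_univ, hi'.injective.encard_image]; simp
  rw [← h1]
  exact hI.encard_le_eRk_of_subset (range_subset_iff.2 hs)

theorem fs_td_eq {F : Type*} [Field F] [CharZero F] (A : Set F) (hA : A.Finite) :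
    (td A ∅ : ℕ∞) = (fsM F).eRk A := by
  refine le_antisymm (fs_td_le A hA) ?_
  simpa using fs_rk_le A ∅ hA

theorem fs_rk_K {F : Type*} [Field F] [CharZero F] (Kf : IntermediateField ℚ F) (d : ℕ)
    (hd : ∀ (n : ℕ) (s : Fin n → F), (∀ i, s i ∈ Kf) → AlgebraicIndependent ℚ s → n ≤ d) :
    (fsM F).eRk (Kf : Set F) ≤ d := by
  rw [Matroid.eRk_le_iff]
  intro I hIK hI
  rw [AlgebraicIndependent.matroid_indep_iff] at hI
  by_contra hlt
  rw [not_le] at hlt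
  have : ((d + 1 : ℕ) : ℕ∞) ≤ I.encard := by
    push_cast
    exact Order.add_one_le_of_lt hlt
  obtain ⟨J, hJI, hJ⟩ := exists_subset_encard_eq this
  have hJf : J.Finite := finite_of_encard_eq_coe hJ
  have hJc : Nat.card J = d + 1 := by
    rw [Nat.card_coe_set_eq, ncard_def, hJ]; rfl
  have := hJf.to_subtype
  let e : Fin (d + 1) ≃ J := (Finite.equivFinOfCardEq (α := J) hJc).symm
  have := hd (d + 1) (fun i => (e i : F)) (fun i => hIK (hJI (e i).2))
    (AlgebraicIndependent.comp (AlgebraicIndepOn.mono hI hJI) e e.injective)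
  omega

theorem fs_part1 {F : Type} [Field F] [CharZero F] (Kf : IntermediateField ℚ F) (d : ℕ)
    (hd : ∀ (n : ℕ) (s : Fin n → F), (∀ i, s i ∈ Kf) → AlgebraicIndependent ℚ s → n ≤ d)
    (A E : Set F) (hA : A.Finite) (hE : E.Finite) :
    td (A ∪ E) ∅ ≤ d + ldim Kf A ∅ + td E ∅ := by
  rw [fs_ldim_empty A hA]
  obtain ⟨b, hbA, hspan, hli⟩ := exists_linearIndependent Kf A
  have hbf : b.Finite := hA.subset hbA
  have hbc : b.ncard = Module.finrank Kf (span Kf A) := by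
    rw [← hspan]
    have := hbf.fintype
    rw [finrank_span_set_eq_card hli, ncard_eq_toFinset_card']
  have hsub : A ∪ E ⊆ (fsM F).closure ((Kf : Set F) ∪ b ∪ E) := by
    refine union_subset ?_ ?_
    · intro x hx
      rw [fs_mem_closure]
      have hx' : x ∈ span Kf b := hspan ▸ subset_span hx
      have : x ∈ Algebra.adjoin ℚ ((Kf : Set F) ∪ b ∪ E) := by
        clear hx
        induction hx' using Submodule.span_induction with
        | mem y hy => exact Algebra.subset_adjoin (Or.inl (Or.inr hy))
        | zero => exact zero_mem _
        | add y w _ _ hy hw => exact add_mem hy hw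
        | smul c y _ hy =>
          rw [Algebra.smul_def]
          exact mul_mem (Algebra.subset_adjoin (Or.inl (Or.inl c.2))) hy
      exact isAlgebraic_algebraMap
        (⟨x, this⟩ : Algebra.adjoin ℚ ((Kf : Set F) ∪ b ∪ E))
    · exact subset_union_right.trans ((fsM F).subset_closure _ (subset_univ _))
  have h : ((td (A ∪ E) ∅ : ℕ) : ℕ∞) ≤ ((d + b.ncard + td E ∅ : ℕ) : ℕ∞) := by
    rw [fs_td_eq _ (hA.union hE)]
    push_cast
    rw [fs_td_eq _ hE]
    calc (fsM F).eRk (A ∪ E) ≤ (fsM F).eRk ((fsM F).closure ((Kf : Set F) ∪ b ∪ E)) :=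
          (fsM F).eRk_mono hsub
      _ = (fsM F).eRk ((Kf : Set F) ∪ b ∪ E) := (fsM F).eRk_closure_eq _
      _ ≤ (fsM F).eRk ((Kf : Set F) ∪ b) + (fsM F).eRk E := (fsM F).eRk_union_le_eRk_add_eRk _ _
      _ ≤ ((fsM F).eRk (Kf : Set F) + b.encard) + (fsM F).eRk E := by
          gcongr; exact (fsM F).eRk_union_le_eRk_add_encard _ _
      _ ≤ _ := by
          rw [hbf.cast_ncard_eq]
          gcongr
          exact fs_rk_K Kf d hd
  rw [hbc] at h
  exact_mod_cast h

theorem fs_exp_closure {F : Type} [Field F] [CharZero F] (expF : F → F)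
    (hexp : ∀ x y : F, expF (x + y) = expF x * expF y) (h0 : expF 0 = 1) (A : Set F) :
    expF '' (span ℚ A : Set F) ⊆ (fsM F).closure (expF '' A) := by
  rintro _ ⟨x, hx, rfl⟩
  have hinv : ∀ y : F, expF (-y) = (expF y)⁻¹ := fun y => by
    have := hexp y (-y)
    rw [add_neg_cancel, h0] at this
    exact (inv_eq_of_mul_eq_one_right this.symm).symm
  have hnat : ∀ (n : ℕ) (y : F), expF (n • y) = expF y ^ n := fun n y => by
    induction n with
    | zero => simp [h0]
    | succ n ih => rw [succ_nsmul, hexp, ih, pow_succ]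
  have hint : ∀ (n : ℤ) (y : F), expF (n • y) = expF y ^ n := fun n y => by
    cases n with
    | ofNat n => simpa using hnat n y
    | negSucc n => rw [negSucc_zsmul, hinv, hnat, zpow_negSucc]
  rw [fs_mem_closure]
  induction (show x ∈ span ℚ A from hx) using Submodule.span_induction with
  | mem y hy =>
    exact isAlgebraic_algebraMap
      (⟨expF y, Algebra.subset_adjoin ⟨y, hy, rfl⟩⟩ : Algebra.adjoin ℚ (expF '' A))
  | zero => rw [h0]; exact isAlgebraic_one
  | add y w hy' hw' hy hw => rw [hexp]; exact (hy hy').mul (hw hw')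
  | smul c y hy' hy =>
    have hy := hy hy'
    refine IsAlgebraic.of_pow (n := c.den) c.den_pos ?_
    have : expF (c • y) ^ c.den = expF y ^ c.num := by
      rw [← hnat, ← hint]
      congr 1
      rw [← Nat.cast_smul_eq_nsmul ℚ, smul_smul, Rat.den_mul_eq_num, Int.cast_smul_eq_zsmul]
    rw [this]
    cases c.num with
    | ofNat n => simpa using hy.pow n
    | negSucc n => rw [zpow_negSucc]; exact (hy.pow _).inv

/-- **Finitely generated strong substructures** (Lemma `fingenstrong`): if `F` is an
exponential field with the Schanuel property and `Kf ⊆ F` is a subfield of transcendence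
degree at most `d`, then δ^K(z) ≥ −d for all finite tuples `z`; consequently some finite
tuple `a` achieves the minimal value of δ^K, and `⟨a⟩_ℚ` is a strong partial K-powered
subfield. -/
theorem fingen_strong {F : Type} [Field F] [CharZero F] (expF : F → F)
    (hexp : ∀ x y : F, expF (x + y) = expF x * expF y)
    (hSchanuel : ∀ (n : ℕ) (z : Fin n → F),
      0 ≤ (td (Set.range z ∪ expF '' Set.range z) ∅ : ℤ) - (ldim ℚ (Set.range z) ∅ : ℤ))
    (Kf : IntermediateField ℚ F) (d : ℕ)
    (hd : ∀ (n : ℕ) (s : Fin n → F), (∀ i, s i ∈ Kf) → AlgebraicIndependent ℚ s → n ≤ d) :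
    (∀ (n : ℕ) (z : Fin n → F),
      -(d : ℤ) ≤ (ldim ↥Kf (Set.range z) ∅ : ℤ) + (td (expF '' Set.range z) (expF '' ∅) : ℤ) -
        (ldim ℚ (Set.range z) ∅ : ℤ)) ∧
    ∃ (m : ℕ) (a : Fin m → F),
      (∀ (k : ℕ) (z : Fin k → F),
        (ldim ↥Kf (Set.range a) ∅ : ℤ) + (td (expF '' Set.range a) (expF '' ∅) : ℤ) -
          (ldim ℚ (Set.range a) ∅ : ℤ) ≤
        (ldim ↥Kf (Set.range z) ∅ : ℤ) + (td (expF '' Set.range z) (expF '' ∅) : ℤ) -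
          (ldim ℚ (Set.range z) ∅ : ℤ)) ∧
      (∀ (k : ℕ) (z : Fin k → F),
        0 ≤ (ldim ↥Kf (Set.range z) (span ℚ (Set.range a) : Set F) : ℤ) +
          (td (expF '' Set.range z) (expF '' (span ℚ (Set.range a) : Set F)) : ℤ) -
          (ldim ℚ (Set.range z) (span ℚ (Set.range a) : Set F) : ℤ)) := by
  have h0 : expF 0 = 1 := by
    by_contra hne
    have h00 : expF 0 = 0 := by
      have := hexp 0 0
      rw [add_zero] at this
      have h2 : expF 0 * (expF 0 - 1) = 0 := by rw [mul_sub, ← this]; ring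
      rcases mul_eq_zero.1 h2 with h | h
      · exact h
      · exact absurd (sub_eq_zero.1 h) hne
    have hz : ∀ x, expF x = 0 := fun x => by
      have := hexp x 0
      rwa [add_zero, h00, mul_zero] at this
    have hS := hSchanuel 1 (fun _ => 1)
    rw [fs_ldim_empty _ (finite_range _)] at hS
    have hr : range (fun _ : Fin 1 => (1 : F)) = {1} := range_const
    rw [hr, finrank_span_singleton (one_ne_zero)] at hS
    have hfin : (({1} : Set F) ∪ expF '' {1}).Finite :=
      (finite_singleton _).union ((finite_singleton _).image _)
    have ht : td (({1} : Set F) ∪ expF '' {1}) ∅ = 0 := by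
      have : ((td (({1} : Set F) ∪ expF '' {1}) ∅ : ℕ) : ℕ∞) ≤ 0 := by
        rw [fs_td_eq _ hfin, ← (fsM F).eRk_empty, ← (fsM F).eRk_closure_eq ∅]
        refine (fsM F).eRk_mono ?_
        rintro x (hx | ⟨y, -, hx⟩)
        · rw [fs_mem_closure, mem_singleton_iff.1 hx]; exact isAlgebraic_one
        · rw [fs_mem_closure, ← hx, hz]; exact isAlgebraic_zero
      simpa using this
    rw [ht] at hS
    norm_num at hS
  have part1 : ∀ (n : ℕ) (z : Fin n → F),
      -(d : ℤ) ≤ (ldim ↥Kf (Set.range z) ∅ : ℤ) + (td (expF '' Set.range z) (expF '' ∅) : ℤ) -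
        (ldim ℚ (Set.range z) ∅ : ℤ) := by
    intro n z
    have h1 := hSchanuel n z
    have h2 := fs_part1 Kf d hd (range z) (expF '' range z) (finite_range _)
      ((finite_range _).image _)
    rw [image_empty]
    omega
  refine ⟨part1, ?_⟩
  let δ : (Σ n : ℕ, (Fin n → F)) → ℤ := fun p =>
    (ldim ↥Kf (Set.range p.2) ∅ : ℤ) + (td (expF '' Set.range p.2) (expF '' ∅) : ℤ) -
        (ldim ℚ (Set.range p.2) ∅ : ℤ)
  obtain ⟨⟨m, a⟩, hmin⟩ : ∃ p, ∀ q, δ p ≤ δ q := by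
    have hne : ∃ v : ℤ, ∃ p, δ p = v := ⟨_, ⟨0, Fin.elim0⟩, rfl⟩
    obtain ⟨v, ⟨p, hp⟩, hv⟩ := Int.exists_least_of_bdd (P := fun v => ∃ p, δ p = v)
      ⟨-(d : ℤ), by rintro _ ⟨p, rfl⟩; exact part1 p.1 p.2⟩ hne
    exact ⟨p, fun q => hp ▸ hv _ ⟨q, rfl⟩⟩
  refine ⟨m, a, fun k z => hmin ⟨k, z⟩, fun k z => ?_⟩
  have hm := hmin ⟨k + m, Fin.append z a⟩
  simp only [δ] at hm
  have hr : range (Fin.append z a) = range z ∪ range a := by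
    ext x
    constructor
    · rintro ⟨i, rfl⟩
      refine Fin.addCases (fun j => ?_) (fun j => ?_) i
      · left; exact ⟨j, by simp⟩
      · right; exact ⟨j, by simp⟩
    · rintro (⟨i, rfl⟩ | ⟨i, rfl⟩)
      · exact ⟨Fin.castAdd m i, by simp⟩
      · exact ⟨Fin.natAdd k i, by simp⟩
  have hfz := finite_range z
  have hfa := finite_range a
  have hspK : span Kf (span ℚ (range a) : Set F) = span Kf (range a) :=
    Submodule.span_span_of_tower ℚ Kf (range a)
  have hspKu : span Kf (range z ∪ (span ℚ (range a) : Set F)) = span Kf (range z ∪ range a) := by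
    rw [span_union, span_union, hspK]
  have hspQu : span ℚ (range z ∪ (span ℚ (range a) : Set F)) = span ℚ (range z ∪ range a) := by
    rw [span_union, span_union, span_eq]
  have hK : ldim Kf (range z) (span ℚ (range a) : Set F) + ldim Kf (range a) ∅ =
      ldim Kf (range z ∪ range a) ∅ := by
    have : FiniteDimensional Kf (span Kf (range z ∪ (span ℚ (range a) : Set F))) := by
      rw [hspKu]; exact FiniteDimensional.span_of_finite _ (hfz.union hfa)
    rw [fs_ldim_empty _ hfa, fs_ldim_empty _ (hfz.union hfa), ← hspKu, ← hspK]
    exact fs_ldim_add _ _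
  have hQ : ldim ℚ (range z) (span ℚ (range a) : Set F) + ldim ℚ (range a) ∅ =
      ldim ℚ (range z ∪ range a) ∅ := by
    have : FiniteDimensional ℚ (span ℚ (range z ∪ (span ℚ (range a) : Set F))) := by
      rw [hspQu]; exact FiniteDimensional.span_of_finite _ (hfz.union hfa)
    rw [fs_ldim_empty _ hfa, fs_ldim_empty _ (hfz.union hfa), ← hspQu]
    have := fs_ldim_add (R := ℚ) (range z) (span ℚ (range a) : Set F)
    rwa [span_eq] at this
  have hT : td (expF '' (range z ∪ range a)) ∅ ≤
      td (expF '' range z) (expF '' (span ℚ (range a) : Set F)) + td (expF '' range a) ∅ := by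
    have h : ((td (expF '' (range z ∪ range a)) ∅ : ℕ) : ℕ∞) ≤
      ((td (expF '' range z) (expF '' (span ℚ (range a) : Set F)) +
        td (expF '' range a) ∅ : ℕ) : ℕ∞) := by
      push_cast
      rw [fs_td_eq _ ((hfz.union hfa).image _), fs_td_eq _ (hfa.image _)]
      calc (fsM F).eRk (expF '' (range z ∪ range a))
          ≤ (fsM F).eRk (expF '' range z ∪ expF '' (span ℚ (range a) : Set F)) := by
            refine (fsM F).eRk_mono ?_
            rw [image_union]
            exact union_subset_union_right _ (image_mono subset_span)
        _ ≤ _ := fs_rk_le _ _ (hfz.image _)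
        _ ≤ _ := by
            gcongr
            rw [← (fsM F).eRk_closure_eq (expF '' range a)]
            exact (fsM F).eRk_mono (fs_exp_closure expF hexp h0 _)
    exact_mod_cast h
  rw [hr, image_empty] at hm
  omega
end

section
/- Let D be a partial K-powered field with a strong Q-subspace D₁ ◁ D, and let D₂ be a finitely generated extension of D₁ contained in D. Then D₂ ◁ D if and only if K-td^D(D₂/D₁) = δ(D₂/D₁), where K-td^D is the dimension function of the pregeometry pcl_K^D associated to the predimension δ. Moreover K-td^D(D₂/D₁) = min{ δ(D'/D₁) : D₂ ⊆ D' ⊆ D, D' finitely generated over D₁ }. -/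
open Set Submodule

variable {K : Type} [Field K] [CharZero K]

/-- Abstract relative rank function attached to a finitary closure operator. -/
structure RK (V : Type*) where
  cl : Set V → Set V
  r : Set V → Set V → ℕ
  sub : ∀ A, A ⊆ cl A
  mono : ∀ {A B}, A ⊆ B → cl A ⊆ cl B
  idem : ∀ A, cl (cl A) ⊆ cl A
  fin : ∀ {A x}, x ∈ cl A → ∃ T, T ⊆ A ∧ T.Finite ∧ x ∈ cl T
  r_empty : ∀ B, r ∅ B = 0
  r_mem : ∀ {A B x}, A.Finite → x ∈ cl (A ∪ B) → r (insert x A) B = r A B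
  r_not : ∀ {A B x}, A.Finite → x ∉ cl (A ∪ B) → r (insert x A) B = r A B + 1
  r_ext : ∀ {A₀ A B}, A₀.Finite → A₀ ⊆ A → A ⊆ cl (A₀ ∪ B) → r A B = r A₀ B

section linear
variable {R : Type*} [DivisionRing R] {V : Type*} [AddCommGroup V] [Module R V]

lemma ldim_eq (A B : Set V) :
    ldim R A B = Module.finrank R (span R ((span R B).mkQ '' A)) := by
  unfold ldim
  set W := span R B with hW
  set U := span R (A ∪ B) with hU
  have h1 : W.comap U.subtype = LinearMap.ker (W.mkQ.comp U.subtype) := by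
    rw [LinearMap.ker_comp, Submodule.ker_mkQ]
  have h2 : LinearMap.range (W.mkQ.comp U.subtype) = span R (W.mkQ '' A) := by
    rw [LinearMap.range_comp, Submodule.range_subtype, hU, Submodule.span_union,
      Submodule.map_sup, ← hW, Submodule.map_span, Submodule.mkQ_map_self, sup_bot_eq]
  rw [h1, (W.mkQ.comp U.subtype).quotKerEquivRange.finrank_eq, h2]

lemma mkQ_mem_span (A B : Set V) (x : V) :
    (span R B).mkQ x ∈ span R ((span R B).mkQ '' A) ↔ x ∈ span R (A ∪ B) := by
  rw [← Submodule.map_span, ← Submodule.mem_comap, Submodule.comap_map_mkQ, Submodule.span_union,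
    sup_comm]

variable (R V) in
/-- The linear rank function. -/
noncomputable def linRK : RK V where
  cl A := span R A
  r A B := ldim R A B
  sub A := subset_span
  mono h := span_mono h
  idem A := by rw [span_span]
  fin := by
    intro A x hx
    obtain ⟨T, h1, h2⟩ := Submodule.mem_span_finite_of_mem_span hx
    exact ⟨T, h1, T.finite_toSet, h2⟩
  r_empty B := by
    rw [ldim_eq, Set.image_empty, Submodule.span_empty, finrank_bot]
  r_mem := by
    intro A B x hA hx
    have := (mkQ_mem_span (R := R) A B x).2 hx
    rw [ldim_eq, ldim_eq, Set.image_insert_eq, Submodule.span_insert_eq_span this]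
  r_not := by
    intro A B x hA hx
    have hx' : ¬ _ := fun h => hx ((mkQ_mem_span (R := R) A B x).1 h)
    rw [ldim_eq, ldim_eq, Set.image_insert_eq]
    set y := (span R B).mkQ x
    set S := (span R B).mkQ '' A with hS
    have hSf : S.Finite := hA.image _
    have : FiniteDimensional R (span R S) := FiniteDimensional.span_of_finite R hSf
    have hy0 : y ≠ 0 := fun h => hx' (by rw [h]; exact zero_mem _)
    have hd : Disjoint (span R {y}) (span R S) :=
      ((Submodule.disjoint_span_singleton' hy0).2 hx').symm
    have := Submodule.finrank_sup_add_finrank_inf_eq (span R {y}) (span R S)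
    rw [disjoint_iff.1 hd, finrank_bot, finrank_span_singleton hy0] at this
    rw [Submodule.span_insert]
    omega
  r_ext := by
    intro A₀ A B hf h0 h1
    rw [ldim_eq, ldim_eq]
    have : span R ((span R B).mkQ '' A) = span R ((span R B).mkQ '' A₀) := by
      apply le_antisymm
      · rw [span_le]
        rintro _ ⟨x, hx, rfl⟩
        exact (mkQ_mem_span A₀ B x).2 (h1 hx)
      · exact span_mono (Set.image_mono h0)
    rw [this]

end linear

section alg
variable {F : Type*} [Field F] [CharZero F]

/-- algebraic closure operator -/
def acl (A : Set F) : Set F := (AlgebraicIndependent.matroid ℚ F).closure A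

lemma acl_rel (A B : Set F) :
    (AlgebraicIndependent.matroid (Algebra.adjoin ℚ B) F).closure A = acl (A ∪ B) := by
  unfold acl
  rw [AlgebraicIndependent.matroid_closure_eq, AlgebraicIndependent.matroid_closure_eq,
    Set.union_comm, Algebra.adjoin_union_eq_adjoin_adjoin]
  ext x
  simp only [SetLike.mem_coe, Subalgebra.mem_algebraicClosure]
  rfl

lemma td_eq {A₀ A B : Set F} (hf : A₀.Finite) (h0 : A₀ ⊆ A) (h1 : A ⊆ acl (A₀ ∪ B)) :
    (td A B : ℕ∞) = (AlgebraicIndependent.matroid (Algebra.adjoin ℚ B) F).eRk A₀ := by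
  set M := AlgebraicIndependent.matroid (Algebra.adjoin ℚ B) F with hM
  have hcl : M.eRk A = M.eRk A₀ := by
    apply le_antisymm
    · rw [← M.eRk_closure_eq A₀]
      apply M.eRk_mono
      rw [hM, acl_rel]; exact h1
    · exact M.eRk_mono h0
  obtain ⟨I, hI⟩ := M.exists_isBasis A₀ (Set.subset_univ _)
  have hIf : I.Finite := hf.subset hI.subset
  have hr : M.eRk A₀ = I.ncard := by rw [← hI.encard_eq_eRk, hIf.cast_ncard_eq]
  rw [hr]
  norm_cast
  unfold td
  apply IsGreatest.csSup_eq
  constructor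
  · have := hIf.fintype
    let e : Fin I.ncard ≃ I := (finCongr (by rw [Set.ncard_eq_toFinset_card' I, Set.toFinset_card])).trans
      (Fintype.equivFin I).symm
    refine ⟨fun i => (e i : F), fun i => h0 (hI.subset (e i).2), ?_⟩
    have hi : AlgebraicIndependent (Algebra.adjoin ℚ B) (fun x : I => (x : F)) := hI.indep
    exact hi.comp e e.injective
  · rintro n ⟨s, hs, hind⟩
    have h2 : M.Indep (Set.range s) := hind.to_subtype_range
    have h3 := h2.encard_le_eRk_of_subset (Set.range_subset_iff.2 hs)
    rw [hcl, hr, ← Set.image_univ, hind.injective.encard_image] at h3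
    simpa using h3

lemma td_fin {A B : Set F} (hf : A.Finite) :
    (td A B : ℕ∞) = (AlgebraicIndependent.matroid (Algebra.adjoin ℚ B) F).eRk A := by
  refine td_eq hf le_rfl ?_
  exact Set.subset_union_left.trans (Matroid.subset_closure _ _ (Set.subset_univ _))

/-- The algebraic rank function, pulled back along a function. -/
noncomputable def algRK {V : Type*} (f : V → F) : RK V where
  cl A := f ⁻¹' acl (f '' A)
  r A B := td (f '' A) (f '' B)
  sub A := fun x hx => Matroid.subset_closure _ _ (Set.subset_univ _) (Set.mem_image_of_mem _ hx)
  mono h := Set.preimage_mono (Matroid.closure_subset_closure _ (Set.image_mono h))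
  idem A := by
    apply Set.preimage_mono
    have h : f '' (f ⁻¹' acl (f '' A)) ⊆ acl (f '' A) := Set.image_preimage_subset _ _
    exact (Matroid.closure_subset_closure _ h).trans (Matroid.closure_closure _ _).le
  fin := by
    intro A x hx
    obtain ⟨T, h1, h2, h3⟩ :=
      Matroid.exists_mem_finite_closure_of_mem_closure (M := AlgebraicIndependent.matroid ℚ F) hx
    obtain ⟨T', h4, rfl⟩ := Set.subset_image_iff.1 h1
    obtain ⟨U, hU, hb⟩ := Set.exists_subset_bijOn T' f
    refine ⟨U, hU.trans h4, hb.finite_iff_finite.2 h2, ?_⟩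
    change f x ∈ acl (f '' U)
    rw [hb.image_eq]
    exact h3.2
  r_empty B := by
    have := td_fin (A := (∅ : Set F)) (B := f '' B) Set.finite_empty
    rw [Matroid.eRk_empty] at this
    rw [Set.image_empty]
    exact_mod_cast this
  r_mem := by
    intro A B x hA hx
    have hx : f x ∈ acl (f '' (A ∪ B)) := hx
    rw [Set.image_union, ← acl_rel] at hx
    have h1 := td_fin (B := f '' B) (hA.image f)
    have h2 := td_fin (B := f '' B) ((hA.insert x).image f)
    rw [Set.image_insert_eq, ← Matroid.eRk_closure_eq,
      Matroid.closure_insert_eq_of_mem_closure hx, Matroid.eRk_closure_eq, ← h1] at h2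
    rw [Set.image_insert_eq]
    exact_mod_cast h2
  r_not := by
    intro A B x hA hx
    have hx : ¬ f x ∈ acl (f '' (A ∪ B)) := hx
    rw [Set.image_union, ← acl_rel] at hx
    have h1 := td_fin (B := f '' B) (hA.image f)
    have h2 := td_fin (B := f '' B) ((hA.insert x).image f)
    rw [Set.image_insert_eq, Matroid.eRk_insert_eq_add_one ⟨Set.mem_univ _, hx⟩, ← h1] at h2
    rw [Set.image_insert_eq]
    exact_mod_cast h2
  r_ext := by
    intro A₀ A B hf h0 h1
    have h2 := td_eq (B := f '' B) (hf.image f) (Set.image_mono h0)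
      (by rw [← Set.image_union]; exact Set.image_subset_iff.2 h1)
    rw [← td_fin (hf.image f)] at h2
    exact_mod_cast h2

end alg

namespace RK
variable {V : Type*} (k : RK V)

lemma cl_le {A B : Set V} (h : A ⊆ k.cl B) : k.cl A ⊆ k.cl B :=
  (k.mono h).trans (k.idem B)

lemma r_step {A B B' : Set V} {x : V} (hA : A.Finite)
    (h : x ∈ k.cl (A ∪ B) ↔ x ∈ k.cl (A ∪ B')) (hr : k.r A B = k.r A B') :
    k.r (insert x A) B = k.r (insert x A) B' := by
  by_cases hx : x ∈ k.cl (A ∪ B)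
  · rw [k.r_mem hA hx, k.r_mem hA (h.1 hx), hr]
  · rw [k.r_not hA hx, k.r_not hA (fun h' => hx (h.2 h')), hr]

lemma r_add {A A' : Set V} (B : Set V) (hA : A.Finite) (hA' : A'.Finite) :
    k.r (A' ∪ A) B = k.r A B + k.r A' (A ∪ B) := by
  induction A', hA' using Set.Finite.induction_on with
  | empty => simp [k.r_empty]
  | @insert x s _ hs ih =>
    rw [Set.insert_union]
    by_cases hx : x ∈ k.cl (s ∪ A ∪ B)
    · rw [k.r_mem (hs.union hA) hx, k.r_mem hs (by rwa [← Set.union_assoc]), ih]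
    · rw [k.r_not (hs.union hA) hx, k.r_not hs (by rwa [← Set.union_assoc]), ih, add_assoc]

lemma r_congr {A B B' : Set V} (hA : A.Finite) (h : k.cl B = k.cl B') : k.r A B = k.r A B' := by
  have h1 : ∀ {B B' : Set V} (s : Set V), k.cl B = k.cl B' → k.cl (s ∪ B) ⊆ k.cl (s ∪ B') := by
    intro B B' s h
    apply k.cl_le
    apply Set.union_subset
    · exact (k.sub s).trans (k.mono Set.subset_union_left)
    · exact (k.sub B).trans (h.le.trans (k.mono Set.subset_union_right))
  induction A, hA using Set.Finite.induction_on with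
  | empty => simp [k.r_empty]
  | @insert x s _ hs ih =>
    exact k.r_step hs ⟨fun hx => h1 s h hx, fun hx => h1 s h.symm hx⟩ ih

lemma r_anti {A B B' : Set V} (hA : A.Finite) (h : B ⊆ B') : k.r A B' ≤ k.r A B := by
  induction A, hA using Set.Finite.induction_on with
  | empty => simp [k.r_empty]
  | @insert x s _ hs ih =>
    by_cases hx' : x ∈ k.cl (s ∪ B')
    · rw [k.r_mem hs hx']
      by_cases hx : x ∈ k.cl (s ∪ B)
      · rwa [k.r_mem hs hx]
      · rw [k.r_not hs hx]; omega
    · have hx : x ∉ k.cl (s ∪ B) := fun h' => hx' (k.mono (Set.union_subset_union_right s h) h')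
      rw [k.r_not hs hx, k.r_not hs hx']; omega

lemma r_le_one (x : V) (B : Set V) : k.r {x} B ≤ 1 := by
  rw [← insert_empty_eq x]
  by_cases hx : x ∈ k.cl (∅ ∪ B)
  · rw [k.r_mem Set.finite_empty hx, k.r_empty]; omega
  · rw [k.r_not Set.finite_empty hx, k.r_empty]

lemma r_eq_one {x : V} {B : Set V} (h : x ∉ k.cl B) : k.r {x} B = 1 := by
  rw [← insert_empty_eq x, k.r_not Set.finite_empty (by simpa using h), k.r_empty]

lemma r_fin {A : Set V} (B : Set V) (hA : A.Finite) :
    ∃ T, T ⊆ B ∧ T.Finite ∧ ∀ W, T ⊆ W → k.r A W ≤ k.r A B := by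
  induction A, hA using Set.Finite.induction_on with
  | empty => exact ⟨∅, by simp, by simp, fun W _ => by simp [k.r_empty]⟩
  | @insert x s _ hs ih =>
    obtain ⟨T, hT, hTf, hTW⟩ := ih
    by_cases hx : x ∈ k.cl (s ∪ B)
    · obtain ⟨U, hU, hUf, hxU⟩ := k.fin hx
      refine ⟨T ∪ (U ∩ B), Set.union_subset hT Set.inter_subset_right,
        hTf.union (hUf.inter_of_left B), fun W hW => ?_⟩
      have hxW : x ∈ k.cl (s ∪ W) := by
        refine k.mono ?_ hxU
        intro u hu
        rcases hU hu with h | h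
        · exact Or.inl h
        · exact Or.inr (hW (Or.inr ⟨hu, h⟩))
      rw [k.r_mem hs hx, k.r_mem hs hxW]
      exact hTW W (Set.subset_union_left.trans hW)
    · refine ⟨T, hT, hTf, fun W hW => ?_⟩
      rw [k.r_not hs hx]
      have := hTW W hW
      by_cases hxW : x ∈ k.cl (s ∪ W)
      · rw [k.r_mem hs hxW]; omega
      · rw [k.r_not hs hxW]; omega

end RK

section subspaces
variable {V : Type*} [AddCommGroup V] [Module ℚ V]

/-- `Z` is finitely generated over `X`. -/
def FGo (X Z : Submodule ℚ V) : Prop := ∃ T : Set V, T.Finite ∧ Z = X ⊔ span ℚ T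

lemma FGo.le {X Z : Submodule ℚ V} (h : FGo X Z) : X ≤ Z := by
  obtain ⟨T, _, rfl⟩ := h; exact le_sup_left

lemma FGo.refl (X : Submodule ℚ V) : FGo X X := ⟨∅, by simp, by simp⟩

lemma FGo.trans {X Y Z : Submodule ℚ V} (h : FGo X Y) (h' : FGo Y Z) : FGo X Z := by
  obtain ⟨T, hT, rfl⟩ := h
  obtain ⟨T', hT', rfl⟩ := h'
  exact ⟨T ∪ T', hT.union hT', by rw [span_union, sup_assoc]⟩

lemma FGo.upper {X Y Z : Submodule ℚ V} (h : FGo X Z) (h1 : X ≤ Y) (h2 : Y ≤ Z) : FGo Y Z := by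
  obtain ⟨T, hT, rfl⟩ := h
  exact ⟨T, hT, le_antisymm (sup_le_sup_right h1 _) (sup_le h2 le_sup_right)⟩

lemma FGo.sup {X Z : Submodule ℚ V} (h : FGo X Z) {Y : Submodule ℚ V} (h1 : X ≤ Y) :
    FGo Y (Y ⊔ Z) := by
  obtain ⟨T, hT, rfl⟩ := h
  exact ⟨T, hT, by rw [← sup_assoc, sup_eq_left.2 h1]⟩

lemma FGo.lower {X Y Z : Submodule ℚ V} (h : FGo X Z) (h1 : X ≤ Y) (h2 : Y ≤ Z) : FGo X Y := by
  obtain ⟨T, hT, rfl⟩ := h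
  have hZ : (X ⊔ span ℚ T).map X.mkQ = span ℚ (X.mkQ '' T) := by
    rw [Submodule.map_sup, Submodule.mkQ_map_self, bot_sup_eq, Submodule.map_span]
  have hle : Y.map X.mkQ ≤ span ℚ (X.mkQ '' T) := hZ ▸ Submodule.map_mono h2
  have : FiniteDimensional ℚ (span ℚ (X.mkQ '' T)) :=
    FiniteDimensional.span_of_finite ℚ (hT.image _)
  have : FiniteDimensional ℚ (Y.map X.mkQ) := Submodule.finiteDimensional_of_le hle
  have hfg : (Y.map X.mkQ).FG := (Submodule.fg_iff_finiteDimensional _).2 this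
  obtain ⟨S, hS, hSe⟩ := Submodule.fg_def.1 hfg
  have hsub : S ⊆ X.mkQ '' Y := by
    rw [← Submodule.map_coe, ← hSe]; exact subset_span
  obtain ⟨U, hU, rfl⟩ := Set.subset_image_iff.1 hsub
  obtain ⟨U', hU', hb⟩ := Set.exists_subset_bijOn U X.mkQ
  refine ⟨U', hb.finite_iff_finite.2 hS, ?_⟩
  rw [← hb.image_eq, ← Submodule.map_span] at hSe
  have := congrArg (Submodule.comap X.mkQ) hSe
  rw [Submodule.comap_map_mkQ, Submodule.comap_map_mkQ, sup_eq_right.2 h1] at this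
  exact this.symm

variable (D : Submodule ℚ V)

/-- compatibility of a rank function with the `ℚ`-structure on `D`. -/
def RK.Good (k : RK V) : Prop := ∀ A : Set V, A ⊆ D → (span ℚ A : Set V) ⊆ k.cl A

variable {D} {k : RK V}

lemma RK.Good.sup_sub (hk : k.Good D) {X : Submodule ℚ V} {T : Set V} (hX : X ≤ D) (hT : T ⊆ D) :
    ((X ⊔ span ℚ T : Submodule ℚ V) : Set V) ⊆ k.cl (T ∪ X) := by
  have := hk (T ∪ X) (Set.union_subset hT hX)
  rwa [span_union, span_eq, sup_comm] at this

lemma RK.Good.r_sup (hk : k.Good D) {X : Submodule ℚ V} {T : Set V} (hf : T.Finite) (hX : X ≤ D) (hT : T ⊆ D) :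
    k.r (X ⊔ span ℚ T : Submodule ℚ V) X = k.r T X :=
  k.r_ext hf (subset_span.trans (SetLike.coe_subset_coe.2 le_sup_right)) (hk.sup_sub hX hT)

lemma RK.Good.cl_sup (hk : k.Good D) {X : Submodule ℚ V} {T : Set V} (hX : X ≤ D) (hT : T ⊆ D) :
    k.cl (T ∪ X) = k.cl (X ⊔ span ℚ T : Submodule ℚ V) := by
  apply le_antisymm
  · apply k.mono
    apply Set.union_subset
    · exact (subset_span.trans (SetLike.coe_subset_coe.2 le_sup_right))
    · exact SetLike.coe_subset_coe.2 le_sup_left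
  · exact k.cl_le (hk.sup_sub hX hT)

lemma RK.Good.add (hk : k.Good D) {X Y Z : Submodule ℚ V} (hZ : Z ≤ D) (h1 : X ≤ Y) (h2 : Y ≤ Z) (h : FGo X Z) :
    k.r Z X = k.r Z Y + k.r Y X := by
  obtain ⟨T', hT', hZe⟩ := h.upper h1 h2
  obtain ⟨T, hT, hYe⟩ := h.lower h1 h2
  have hTD : T ⊆ D := by
    have : span ℚ T ≤ D := le_trans (by rw [hYe]; exact le_sup_right) (h2.trans hZ)
    exact subset_span.trans this
  have hTD' : T' ⊆ D := by
    have : span ℚ T' ≤ D := le_trans (by rw [hZe]; exact le_sup_right) hZ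
    exact subset_span.trans this
  have hXD : X ≤ D := h1.trans (h2.trans hZ)
  have e1 : k.r Y X = k.r T X := by
    conv_lhs => rw [hYe]
    exact hk.r_sup hT hXD hTD
  have e2 : k.r Z Y = k.r T' Y := by
    conv_lhs => rw [hZe]
    exact hk.r_sup hT' (h2.trans hZ) hTD'
  have e3 : k.r Z X = k.r (T' ∪ T) X := by
    have : Z = X ⊔ span ℚ (T' ∪ T) := by
      rw [hZe, hYe, span_union, sup_assoc, sup_comm (span ℚ T')]
    conv_lhs => rw [this]
    exact hk.r_sup (hT'.union hT) hXD (Set.union_subset hTD' hTD)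
  have e4 : k.r T' Y = k.r T' (T ∪ X) := by
    apply k.r_congr hT'
    rw [hk.cl_sup hXD hTD, ← hYe]
  rw [e1, e2, e3, e4, k.r_add _ hT hT', add_comm]

end subspaces

section ratlin
variable {V : Type*} [AddCommGroup V] [Module ℚ V] (D : Submodule ℚ V)

lemma good_lin : (linRK ℚ V).Good D := fun _ _ => le_rfl

/-- modularity of the `ℚ`-dimension. -/
lemma ldim_modular {S Z : Submodule ℚ V} {T : Set V} (hT : T.Finite) (hTZ : T ⊆ Z) :
    ldim ℚ T (S : Set V) = ldim ℚ T ((Z ⊓ S : Submodule ℚ V) : Set V) := by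
  change (linRK ℚ V).r T S = (linRK ℚ V).r T ((Z ⊓ S : Submodule ℚ V) : Set V)
  induction T, hT using Set.Finite.induction_on with
  | empty => simp [RK.r_empty]
  | @insert x s _ hs ih =>
    have hx : x ∈ Z := hTZ (Set.mem_insert _ _)
    have hsZ : s ⊆ Z := (Set.subset_insert _ _).trans hTZ
    refine RK.r_step _ hs ?_ (ih hsZ)
    change x ∈ span ℚ (s ∪ S) ↔ x ∈ span ℚ (s ∪ ((Z ⊓ S : Submodule ℚ V) : Set V))
    rw [span_union, span_union, span_eq, span_eq, inf_comm, ← sup_inf_assoc_of_le]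
    · exact ⟨fun h => ⟨h, hx⟩, fun h => h.1⟩
    · exact span_le.2 hsZ

lemma ldim_lt {X Y Z : Submodule ℚ V} (h1 : X < Y) (h2 : Y ≤ Z) (h : FGo X Z) :
    ldim ℚ (Z : Set V) (Y : Set V) < ldim ℚ (Z : Set V) (X : Set V) := by
  have hg := good_lin (⊤ : Submodule ℚ V)
  have e1 := hg.add le_top h1.le h2 h
  obtain ⟨x, hxY, hxX⟩ := SetLike.exists_of_lt h1
  have hle : X ⊔ span ℚ {x} ≤ Y := sup_le h1.le (span_le.2 (by simpa using hxY))
  have e2 := hg.add le_top le_sup_left hle (h.lower h1.le h2)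
  have e3 := hg.r_sup (X := X) (T := {x}) (by simp) le_top (by simp)
  have e4 : (linRK ℚ V).r {x} X = 1 := by
    apply RK.r_eq_one
    change x ∉ span ℚ (X : Set V)
    rwa [span_eq]
  change (linRK ℚ V).r Z Y < (linRK ℚ V).r Z X
  omega

end ratlin

section predim
variable {V : Type*} [AddCommGroup V] [Module ℚ V]

/-- The properties of the predimension that we use. -/
structure Predim (D : Submodule ℚ V) (d : Submodule ℚ V → Submodule ℚ V → ℤ) : Prop where
  add : ∀ {X Y Z}, Z ≤ D → X ≤ Y → Y ≤ Z → FGo X Z → d Z X = d Z Y + d Y X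
  submod : ∀ {S Z}, S ≤ D → Z ≤ D → FGo (Z ⊓ S) Z → d (S ⊔ Z) S ≤ d Z (Z ⊓ S)
  one : ∀ {X} {x}, X ≤ D → x ∈ D → d (X ⊔ span ℚ {x}) X ≤ 1
  fin : ∀ {C} {T : Set V}, C ≤ D → T ⊆ D → T.Finite → ∃ T₀ : Set V, T₀ ⊆ C ∧ T₀.Finite ∧
    ∀ W ≤ C, T₀ ⊆ W → d (W ⊔ span ℚ T) W ≤ d (C ⊔ span ℚ T) C

/-- strong subspaces -/
def Str (D : Submodule ℚ V) (d : Submodule ℚ V → Submodule ℚ V → ℤ) (X : Submodule ℚ V) : Prop :=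
  X ≤ D ∧ ∀ Z, Z ≤ D → FGo X Z → 0 ≤ d Z X

/-- closed subspaces -/
def Clo (D : Submodule ℚ V) (d : Submodule ℚ V → Submodule ℚ V → ℤ) (S : Submodule ℚ V) : Prop :=
  S ≤ D ∧ ∀ Z, Z ≤ D → FGo S Z → d Z S ≤ 0 → Z ≤ S

variable {D : Submodule ℚ V} {d : Submodule ℚ V → Submodule ℚ V → ℤ}

lemma Predim.self (h : Predim D d) {X : Submodule ℚ V} (hX : X ≤ D) : d X X = 0 := by
  have := h.add hX le_rfl le_rfl (FGo.refl X); omega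

lemma Predim.clo_of (h : Predim D d) {X W S : Submodule ℚ V} (hX : Str D d X) (hS : Clo D d S) (hXS : X ≤ S)
    (hW : W ≤ D) (hXW : FGo X W) (h0 : d W X ≤ 0) : W ≤ S := by
  have hle : X ≤ W ⊓ S := le_inf hXW.le hXS
  have h1 := h.add hW hle inf_le_left hXW
  have h2 := hX.2 (W ⊓ S) (inf_le_left.trans hW) (hXW.lower hle inf_le_left)
  have h3 := h.submod hS.1 hW (hXW.upper hle inf_le_left)
  exact le_sup_right.trans
    (hS.2 (S ⊔ W) (sup_le hS.1 hW) (hXW.sup hXS) (by omega))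

/-- strong extension of zero predimension -/
lemma Predim.str_of_zero (h : Predim D d) {X E : Submodule ℚ V} (hX : Str D d X) (hE : E ≤ D) (hXE : FGo X E)
    (h0 : d E X ≤ 0) : Str D d E := by
  refine ⟨hE, fun Z hZ hEZ => ?_⟩
  have h1 := h.add hZ hXE.le hEZ.le (hXE.trans hEZ)
  have h2 := hX.2 Z hZ (hXE.trans hEZ)
  omega

lemma Predim.exists_tuple (h : Predim D d) (n : ℕ) : ∀ X Z : Submodule ℚ V, Str D d X → Str D d Z → FGo X Z →
    ldim ℚ (Z : Set V) (X : Set V) < n →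
    ∃ (m : ℕ) (s : Fin m → V), (m : ℤ) = d Z X ∧ (∀ i, s i ∈ D) ∧
      ∀ S, Clo D d S → X ≤ S → (∀ i, s i ∈ S) → Z ≤ S := by
  induction n with
  | zero => intro X Z _ _ _ h0; omega
  | succ n ih =>
    intro X Z hX hZ hXZ hn
    by_cases hE : ∃ E, X < E ∧ E ≤ Z ∧ d E X ≤ 0
    · obtain ⟨E, hE1, hE2, hE0⟩ := hE
      have hXE := hXZ.lower hE1.le hE2
      have hED := hE2.trans hZ.1
      have hEs := h.str_of_zero hX hED hXE hE0
      have hlt := ldim_lt hE1 hE2 hXZ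
      obtain ⟨m, s, hm, hs, hcl⟩ := ih E Z hEs hZ (hXZ.upper hE1.le hE2) (by omega)
      have h1 := h.add hZ.1 hE1.le hE2 hXZ
      have h2 := hX.2 E hED hXE
      exact ⟨m, s, by omega, hs, fun S hS hXS hsS =>
        hcl S hS (h.clo_of hX hS hXS hED hXE hE0) hsS⟩
    push Not at hE
    by_cases hXeq : X = Z
    · subst hXeq
      exact ⟨0, Fin.elim0, by rw [h.self hX.1]; rfl, fun i => i.elim0, fun S _ hS _ => hS⟩
    obtain ⟨x, hxZ, hxX⟩ := SetLike.exists_of_lt (lt_of_le_of_ne hXZ.le hXeq)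
    set Y := X ⊔ span ℚ {x} with hY
    have hXY : X < Y := by
      refine lt_of_le_of_ne le_sup_left (fun he => hxX ?_)
      rw [he]
      exact (le_sup_right : span ℚ {x} ≤ Y) (mem_span_singleton_self x)
    have hYZ : Y ≤ Z := sup_le hXZ.le (span_le.2 (by simpa using hxZ))
    have hYD := hYZ.trans hZ.1
    have hXYf : FGo X Y := hXZ.lower hXY.le hYZ
    have hone : d Y X ≤ 1 := h.one hX.1 (hZ.1 hxZ)
    have hpos : 0 < d Y X := hE Y hXY hYZ
    have hYs : Str D d Y := by
      refine ⟨hYD, fun W hW hYW => ?_⟩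
      have hXW := hXYf.trans hYW
      have e1 := h.add hW hXY.le hYW.le hXW
      have hYi : Y ≤ W ⊓ Z := le_inf hYW.le hYZ
      have hXi : X < W ⊓ Z := lt_of_lt_of_le hXY hYi
      have e2 := h.add hW hXi.le inf_le_left hXW
      have e3 := hE _ hXi inf_le_right
      have e4 := h.submod hZ.1 hW (hXW.upper hXi.le inf_le_left)
      have e5 := hZ.2 (Z ⊔ W) (sup_le hZ.1 hW) (hXW.sup hXZ.le)
      omega
    have hlt := ldim_lt hXY hYZ hXZ
    obtain ⟨m, s, hm, hs, hcl⟩ := ih Y Z hYs hZ (hXZ.upper hXY.le hYZ) (by omega)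
    have e := h.add hZ.1 hXY.le hYZ hXZ
    refine ⟨m + 1, Fin.cons x s, by push_cast; omega, ?_, ?_⟩
    · intro i
      refine Fin.cases (hZ.1 hxZ) (fun j => ?_) i
      simpa using hs j
    · intro S hS hXS hsS
      refine hcl S hS (sup_le hXS (span_le.2 ?_)) (fun j => by simpa using hsS j.succ)
      simpa using hsS 0

lemma Predim.exists_min (h : Predim D d) {X Z : Submodule ℚ V} (hX : Str D d X) (hZ : Z ≤ D) (hXZ : FGo X Z) :
    ∃ E, E ≤ D ∧ Z ≤ E ∧ FGo X E ∧ Str D d E ∧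
      ∀ E', E' ≤ D → Z ≤ E' → FGo X E' → d E X ≤ d E' X := by
  let Q : ℕ → Prop := fun n => ∃ E, E ≤ D ∧ Z ≤ E ∧ FGo X E ∧ d E X = n
  have hQ : ∃ n, Q n := ⟨(d Z X).toNat, Z, hZ, le_rfl, hXZ,
    (Int.toNat_of_nonneg (hX.2 Z hZ hXZ)).symm⟩
  classical
  obtain ⟨E, hE, hZE, hXE, hEn⟩ := Nat.find_spec hQ
  have hmin : ∀ E', E' ≤ D → Z ≤ E' → FGo X E' → d E X ≤ d E' X := by
    intro E' hE' hZE' hXE'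
    have h0 := hX.2 E' hE' hXE'
    have := Nat.find_min' hQ (m := (d E' X).toNat)
      ⟨E', hE', hZE', hXE', (Int.toNat_of_nonneg h0).symm⟩
    omega
  refine ⟨E, hE, hZE, hXE, ⟨hE, fun W hW hEW => ?_⟩, hmin⟩
  have e1 := h.add hW hXE.le hEW.le (hXE.trans hEW)
  have e2 := hmin W hW (hZE.trans hEW.le) (hXE.trans hEW)
  omega

/-- explicit description of the closure of a strong subspace -/
lemma Predim.exists_closed (h : Predim D d) {E : Submodule ℚ V} (hE : Str D d E) :
    ∃ C, Clo D d C ∧ E ≤ C ∧ ∀ T : Set V, T.Finite → T ⊆ C →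
      ∃ W, W ≤ D ∧ FGo E W ∧ d W E ≤ 0 ∧ T ⊆ W := by
  let 𝒲 : Set (Submodule ℚ V) := {W | W ≤ D ∧ FGo E W ∧ d W E ≤ 0}
  have hEmem : E ∈ 𝒲 := ⟨hE.1, FGo.refl E, (h.self hE.1).le⟩
  have hsup : ∀ W ∈ 𝒲, ∀ W' ∈ 𝒲, W ⊔ W' ∈ 𝒲 := by
    rintro W ⟨hW, hEW, hW0⟩ W' ⟨hW', hEW', hW0'⟩
    have hf := hEW'.sup hEW.le
    have hD := sup_le hW hW'
    refine ⟨hD, hEW.trans hf, ?_⟩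
    have hi : E ≤ W' ⊓ W := le_inf hEW'.le hEW.le
    have e1 := h.add hD hEW.le le_sup_left (hEW.trans hf)
    have e2 := h.submod hW hW' (hEW'.upper hi inf_le_left)
    have e3 := h.add hW' hi inf_le_left hEW'
    have e4 := hE.2 _ (inf_le_left.trans hW') (hEW'.lower hi inf_le_left)
    omega
  have hdir : DirectedOn (· ≤ ·) 𝒲 := fun W hW W' hW' =>
    ⟨W ⊔ W', hsup W hW W' hW', le_sup_left, le_sup_right⟩
  have hmem : ∀ x, x ∈ sSup 𝒲 ↔ ∃ W ∈ 𝒲, x ∈ W := fun x =>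
    Submodule.mem_sSup_of_directed ⟨E, hEmem⟩ hdir
  have hfinite : ∀ T : Set V, T.Finite → T ⊆ (sSup 𝒲 : Submodule ℚ V) → ∃ W ∈ 𝒲, T ⊆ W := by
    intro T hT
    induction T, hT using Set.Finite.induction_on with
    | empty => intro _; exact ⟨E, hEmem, by simp⟩
    | @insert x s _ hs ih =>
      intro hsub
      obtain ⟨W, hW, hsW⟩ := ih ((Set.subset_insert _ _).trans hsub)
      obtain ⟨W', hW', hxW'⟩ := (hmem x).1 (hsub (Set.mem_insert _ _))
      refine ⟨W ⊔ W', hsup W hW W' hW', Set.insert_subset ?_ ?_⟩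
      · exact (le_sup_right : W' ≤ W ⊔ W') hxW'
      · exact hsW.trans (SetLike.coe_subset_coe.2 le_sup_left)
  have hCD : sSup 𝒲 ≤ D := sSup_le fun W hW => hW.1
  refine ⟨sSup 𝒲, ⟨hCD, ?_⟩, le_sSup hEmem, ?_⟩
  · rintro Z hZ ⟨T, hT, rfl⟩ h0
    have hTD : T ⊆ D := subset_span.trans (SetLike.coe_subset_coe.2 (le_sup_right.trans hZ))
    obtain ⟨T₀, hT₀, hT₀f, hfin⟩ := h.fin hCD hTD hT
    obtain ⟨W, hW, hTW⟩ := hfinite T₀ hT₀f hT₀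
    have e1 := hfin W (le_sSup hW) hTW
    have hWT : FGo W (W ⊔ span ℚ T) := ⟨T, hT, rfl⟩
    have hD : W ⊔ span ℚ T ≤ D := sup_le hW.1 (span_le.2 hTD)
    have e2 := h.add hD hW.2.1.le le_sup_left (hW.2.1.trans hWT)
    have e3 := hW.2.2
    have : W ⊔ span ℚ T ∈ 𝒲 := ⟨hD, hW.2.1.trans hWT, by omega⟩
    exact sup_le le_rfl (le_sup_right.trans (le_sSup this))
  · intro T hT hTC
    obtain ⟨W, hW, hTW⟩ := hfinite T hT hTC
    exact ⟨W, hW.1, hW.2.1, hW.2.2, hTW⟩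

lemma Predim.le_card (h : Predim D d) {X : Submodule ℚ V} (hX : X ≤ D) : ∀ (m : ℕ) (s : Fin m → V),
    (∀ i, s i ∈ D) → d (X ⊔ span ℚ (Set.range s)) X ≤ m := by
  intro m
  induction m with
  | zero =>
    intro s _
    rw [Set.range_eq_empty, span_empty, sup_bot_eq, h.self hX]; simp
  | succ m ih =>
    intro s hs
    set Y := X ⊔ span ℚ (Set.range (fun i : Fin m => s i.castSucc)) with hY
    have hYD : Y ≤ D := sup_le hX (span_le.2 (Set.range_subset_iff.2 fun i => hs _))
    have he : X ⊔ span ℚ (Set.range s) = Y ⊔ span ℚ {s (Fin.last m)} := by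
      rw [hY, sup_assoc, ← span_union]
      congr 2
      ext v
      simp only [Set.mem_range, Set.mem_union, Set.mem_singleton_iff]
      constructor
      · rintro ⟨i, rfl⟩
        refine Fin.lastCases (Or.inr rfl) (fun j => Or.inl ⟨j, rfl⟩) i
      · rintro (⟨i, rfl⟩ | rfl)
        · exact ⟨_, rfl⟩
        · exact ⟨_, rfl⟩
    rw [he]
    have hlast : span ℚ {s (Fin.last m)} ≤ D := span_le.2 (by simpa using hs _)
    have hf : FGo X Y := ⟨_, Set.finite_range _, rfl⟩
    have hf' : FGo Y (Y ⊔ span ℚ {s (Fin.last m)}) := ⟨_, Set.finite_singleton _, rfl⟩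
    have e1 := h.add (sup_le hYD hlast) hf.le le_sup_left (hf.trans hf')
    have e2 := h.one hYD (hs (Fin.last m))
    have e3 : d Y X ≤ m := ih (fun i => s i.castSucc) (fun i => hs _)
    push_cast
    omega

/-- The dimension equals the minimum of the predimension. -/
lemma Predim.main (h : Predim D d) {X Z : Submodule ℚ V} (hX : Str D d X) (hZ : Z ≤ D) (hXZ : FGo X Z) :
    ∃ E, E ≤ D ∧ Z ≤ E ∧ FGo X E ∧ Str D d E ∧
      (∀ E', E' ≤ D → Z ≤ E' → FGo X E' → d E X ≤ d E' X) ∧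
      ((sInf {m | ∃ s : Fin m → V, (∀ i, s i ∈ D) ∧
        ∀ S, Clo D d S → X ≤ S → (∀ i, s i ∈ S) → Z ≤ S} : ℕ) : ℤ) = d E X := by
  obtain ⟨E, hE, hZE, hXE, hEs, hmin⟩ := h.exists_min hX hZ hXZ
  refine ⟨E, hE, hZE, hXE, hEs, hmin, ?_⟩
  obtain ⟨m, s, hm, hs, hcl⟩ := h.exists_tuple _ X E hX hEs hXE (Nat.lt_succ_self _)
  set Q : Set ℕ := {m | ∃ s : Fin m → V, (∀ i, s i ∈ D) ∧
        ∀ S, Clo D d S → X ≤ S → (∀ i, s i ∈ S) → Z ≤ S} with hQ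
  have hmQ : m ∈ Q := ⟨s, hs, fun S hS h1 h2 => hZE.trans (hcl S hS h1 h2)⟩
  apply le_antisymm
  · rw [← hm]; exact_mod_cast Nat.sInf_le hmQ
  · obtain ⟨t, ht, htS⟩ := Nat.sInf_mem ⟨m, hmQ⟩
    set X' := X ⊔ span ℚ (Set.range t) with hX'
    have hX'D : X' ≤ D := sup_le hX.1 (span_le.2 (Set.range_subset_iff.2 ht))
    have hXX' : FGo X X' := ⟨_, Set.finite_range _, rfl⟩
    obtain ⟨E', hE', hXE', hf', hEs', hmin'⟩ := h.exists_min hX hX'D hXX'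
    obtain ⟨C, hC, hEC, hCT⟩ := h.exists_closed hEs'
    have hZC : Z ≤ C := by
      refine htS C hC (hf'.le.trans hEC) (fun i => hEC (hXE' ?_))
      exact (le_sup_right : _ ≤ X') (subset_span ⟨i, rfl⟩)
    obtain ⟨T, hT, rfl⟩ := hXZ
    obtain ⟨W, hW, hEW, hW0, hTW⟩ := hCT T hT
      (subset_span.trans (SetLike.coe_subset_coe.2 (le_sup_right.trans hZC)))
    have e1 := hmin W hW (sup_le (hf'.le.trans hEW.le) (span_le.2 hTW)) (hf'.trans hEW)
    have e2 := h.add hW hf'.le hEW.le (hf'.trans hEW)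
    have e3 := hmin' X' hX'D le_rfl hXX'
    have e4 : d X' X ≤ _ := h.le_card hX.1 _ t ht
    omega

end predim

section concrete
variable {K : Type} [Field K] [CharZero K] (P : PPF K)

lemma mem_acl {F : Type*} [Field F] [CharZero F] {A : Set F} {x : F} :
    x ∈ acl A ↔ IsAlgebraic (Algebra.adjoin ℚ A) x := by
  unfold acl
  rw [AlgebraicIndependent.matroid_closure_eq, SetLike.mem_coe, Subalgebra.mem_algebraicClosure]

lemma PPF.exp_zero' : P.exp 0 = 1 := by
  have h := P.exp_add 0 (zero_mem _) 0 (zero_mem _)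
  rw [add_zero] at h
  have h0 := P.exp_ne_zero 0 (zero_mem _)
  exact (mul_eq_left₀ h0).1 h.symm

lemma PPF.exp_nsmul' {x : P.V} (hx : x ∈ P.D) (n : ℕ) : P.exp (n • x) = P.exp x ^ n := by
  induction n with
  | zero => simp [P.exp_zero']
  | succ n ih => rw [succ_nsmul, P.exp_add _ (P.D.nsmul_mem hx n) _ hx, ih, pow_succ]

lemma PPF.exp_neg' {x : P.V} (hx : x ∈ P.D) : P.exp (-x) = (P.exp x)⁻¹ := by
  have h := P.exp_add x hx (-x) (P.D.neg_mem hx)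
  rw [add_neg_cancel, P.exp_zero'] at h
  exact eq_inv_of_mul_eq_one_right h.symm

lemma PPF.acl_smul {A : Set P.F} {x : P.V} (hx : x ∈ P.D) (h : P.exp x ∈ acl A) (q : ℚ) :
    P.exp (q • x) ∈ acl A := by
  rw [mem_acl] at *
  have hz : ∀ n : ℕ, IsAlgebraic (Algebra.adjoin ℚ A) (P.exp (n • x)) := fun n => by
    rw [P.exp_nsmul' hx]; exact h.pow n
  have hz' : IsAlgebraic (Algebra.adjoin ℚ A) (P.exp (q.num • x)) := by
    rcases Int.natAbs_eq q.num with h' | h' <;> rw [h']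
    · rw [natCast_zsmul]; exact hz _
    · rw [neg_smul, natCast_zsmul, P.exp_neg' (P.D.nsmul_mem hx _)]
      exact (hz _).inv
  have he : q.den • (q • x) = q.num • x := by
    rw [← Nat.cast_smul_eq_nsmul ℚ, ← Int.cast_smul_eq_zsmul ℚ, smul_smul, Rat.den_mul_eq_num]
  rw [← he, P.exp_nsmul' (P.D.smul_mem q hx)] at hz'
  exact hz'.of_pow q.den_pos

lemma PPF.good_alg : (algRK P.exp).Good P.D := by
  intro A hA x hx
  have : x ∈ P.D ∧ P.exp x ∈ acl (P.exp '' A) := by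
    induction hx using Submodule.span_induction with
    | mem x hx => exact ⟨hA hx, (algRK P.exp).sub A hx⟩
    | zero =>
      refine ⟨zero_mem _, ?_⟩
      rw [P.exp_zero', mem_acl]; exact isAlgebraic_one
    | add x y _ _ hx hy =>
      refine ⟨add_mem hx.1 hy.1, ?_⟩
      rw [P.exp_add _ hx.1 _ hy.1, mem_acl]
      exact (mem_acl.1 hx.2).mul (mem_acl.1 hy.2)
    | smul q x _ hx => exact ⟨P.D.smul_mem q hx.1, P.acl_smul hx.1 hx.2 q⟩
  exact this.2

lemma PPF.good_K : (linRK K P.V).Good P.D := by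
  intro A _
  exact Submodule.span_subset_span ℚ K A

/-- The rank functions recombine to the predimension. -/
lemma PPF.delta_eq (A B : Set P.V) : P.delta A B =
    ((linRK K P.V).r A B : ℤ) + ((algRK P.exp).r A B : ℤ) - ((linRK ℚ P.V).r A B : ℤ) := rfl

lemma PPF.delta_sup {X : Submodule ℚ P.V} {T : Set P.V} (hT : T.Finite) (hX : X ≤ P.D)
    (hTD : T ⊆ P.D) : P.delta (X ⊔ span ℚ T : Submodule ℚ P.V) X = P.delta T X := by
  rw [P.delta_eq, P.delta_eq, P.good_K.r_sup hT hX hTD, P.good_alg.r_sup hT hX hTD,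
    (good_lin P.D).r_sup hT hX hTD]

lemma PPF.predim : Predim P.D (fun Z X => P.delta (Z : Set P.V) (X : Set P.V)) where
  add := by
    intro X Y Z hZ h1 h2 h
    simp only [P.delta_eq]
    rw [P.good_K.add hZ h1 h2 h, P.good_alg.add hZ h1 h2 h, (good_lin P.D).add hZ h1 h2 h]
    push_cast
    ring
  submod := by
    intro S Z hS hZ h
    obtain ⟨T, hT, hZe⟩ := h
    have hTZ : T ⊆ Z := subset_span.trans
      (SetLike.coe_subset_coe.2 (le_sup_right.trans hZe.ge))
    have hTD : T ⊆ P.D := hTZ.trans hZ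
    have hsup : S ⊔ Z = S ⊔ span ℚ T := by
      rw [hZe, ← sup_assoc]
      congr 1
      exact sup_eq_left.2 inf_le_right
    have e1 := P.delta_sup hT hS hTD
    have e2 := P.delta_sup hT (X := Z ⊓ S) (inf_le_left.trans hZ) hTD
    rw [← hZe] at e2
    rw [← hsup] at e1
    change P.delta _ _ ≤ P.delta _ _
    rw [e1, e2, P.delta_eq, P.delta_eq]
    have hsub : ((Z ⊓ S : Submodule ℚ P.V) : Set P.V) ⊆ S := SetLike.coe_subset_coe.2 inf_le_right
    have a1 := (linRK K P.V).r_anti hT hsub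
    have a2 := (algRK P.exp).r_anti hT hsub
    have a3 : (linRK ℚ P.V).r T S = (linRK ℚ P.V).r T ((Z ⊓ S : Submodule ℚ P.V) : Set P.V) :=
      ldim_modular hT hTZ
    omega
  one := by
    intro X x hX hx
    change P.delta _ _ ≤ 1
    rw [P.delta_sup (Set.finite_singleton x) hX (by simpa using hx), P.delta_eq]
    have a1 := (linRK K P.V).r_le_one x X
    have a2 := (algRK P.exp).r_le_one x X
    by_cases hxX : x ∈ X
    · have hle : ∀ k : RK P.V, k.r {x} X = 0 := fun k => by
        rw [← insert_empty_eq x, k.r_mem Set.finite_empty (k.sub _ (Or.inr hxX)), k.r_empty]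
      simp only [hle]; norm_num
    · have a3 : (linRK ℚ P.V).r {x} X = 1 := by
        apply RK.r_eq_one
        change x ∉ span ℚ (X : Set P.V)
        rwa [span_eq]
      omega
  fin := by
    intro C T hC hTD hT
    obtain ⟨T₁, h1, h1f, h1W⟩ := (linRK K P.V).r_fin C hT
    obtain ⟨T₂, h2, h2f, h2W⟩ := (algRK P.exp).r_fin C hT
    refine ⟨T₁ ∪ T₂, Set.union_subset h1 h2, h1f.union h2f, fun W hW hTW => ?_⟩
    change P.delta _ _ ≤ P.delta _ _
    rw [P.delta_sup hT hC hTD, P.delta_sup hT (hW.trans hC) hTD, P.delta_eq, P.delta_eq]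
    have a1 := h1W W (Set.subset_union_left.trans hTW)
    have a2 := h2W W (Set.subset_union_right.trans hTW)
    have a3 := (linRK ℚ P.V).r_anti hT (SetLike.coe_subset_coe.2 hW)
    omega

lemma FGo_iff {V : Type*} [AddCommGroup V] [Module ℚ V] {X Z : Submodule ℚ V} :
    FGo X Z ↔ ∃ (m : ℕ) (b : Fin m → V), Z = X ⊔ span ℚ (Set.range b) := by
  constructor
  · rintro ⟨T, hT, rfl⟩
    obtain ⟨n, f, hf⟩ := hT.fin_param
    exact ⟨n, f, by rw [hf.2]⟩
  · rintro ⟨m, b, rfl⟩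
    exact ⟨_, Set.finite_range b, rfl⟩

lemma PPF.str_iff {X : Submodule ℚ P.V} (hX : X ≤ P.D) :
    Str P.D (fun Z X => P.delta (Z : Set P.V) (X : Set P.V)) X ↔
    ∀ (n : ℕ) (z : Fin n → P.V), (∀ i, z i ∈ P.D) → 0 ≤ P.delta (Set.range z) (X : Set P.V) := by
  constructor
  · intro h n z hz
    have hz' := Set.range_subset_iff.2 hz
    rw [← P.delta_sup (Set.finite_range z) hX hz']
    exact h.2 _ (sup_le hX (span_le.2 hz')) ⟨_, Set.finite_range z, rfl⟩
  · intro h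
    refine ⟨hX, fun Z hZ hXZ => ?_⟩
    obtain ⟨m, b, rfl⟩ := FGo_iff.1 hXZ
    have hb : Set.range b ⊆ P.D :=
      subset_span.trans (SetLike.coe_subset_coe.2 (le_sup_right.trans hZ))
    change 0 ≤ P.delta _ _
    rw [P.delta_sup (Set.finite_range b) hX hb]
    exact h m b (Set.range_subset_iff.1 hb)

lemma PPF.clo_iff {S : Submodule ℚ P.V} (hS : S ≤ P.D) :
    Clo P.D (fun Z X => P.delta (Z : Set P.V) (X : Set P.V)) S ↔
    ∀ (n : ℕ) (z : Fin n → P.V), (∀ i, z i ∈ P.D) →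
      P.delta (Set.range z) (S : Set P.V) ≤ 0 → ∀ i, z i ∈ S := by
  constructor
  · intro h n z hz h0 i
    have hz' := Set.range_subset_iff.2 hz
    rw [← P.delta_sup (Set.finite_range z) hS hz'] at h0
    have := h.2 _ (sup_le hS (span_le.2 hz')) ⟨_, Set.finite_range z, rfl⟩ h0
    exact this ((le_sup_right : span ℚ (Set.range z) ≤ _) (subset_span ⟨i, rfl⟩))
  · intro h
    refine ⟨hS, fun Z hZ hSZ h0 => ?_⟩
    obtain ⟨m, b, rfl⟩ := FGo_iff.1 hSZ
    have hb : Set.range b ⊆ P.D :=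
      subset_span.trans (SetLike.coe_subset_coe.2 (le_sup_right.trans hZ))
    change P.delta _ _ ≤ 0 at h0
    rw [P.delta_sup (Set.finite_range b) hS hb] at h0
    exact sup_le le_rfl (span_le.2 (Set.range_subset_iff.2
      (h m b (Set.range_subset_iff.1 hb) h0)))

lemma PPF.ktd_eq (D₁ D₂ : Submodule ℚ P.V) : P.ktdIn P.D (D₂ : Set P.V) (D₁ : Set P.V) =
    sInf {m | ∃ s : Fin m → P.V, (∀ i, s i ∈ P.D) ∧
        ∀ S, Clo P.D (fun Z X => P.delta (Z : Set P.V) (X : Set P.V)) S →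
          D₁ ≤ S → (∀ i, s i ∈ S) → D₂ ≤ S} := by
  unfold PPF.ktdIn PPF.pclIn
  congr 1
  ext m
  simp only [Set.mem_ofPred_eq]
  refine exists_congr fun s => and_congr_right fun _ => ?_
  rw [SetLike.coe_subset_coe, le_sInf_iff]
  constructor
  · intro h S hS h1 h2
    exact h S ⟨Set.union_subset h1 (Set.range_subset_iff.2 h2), hS.1, (P.clo_iff hS.1).1 hS⟩
  · rintro h S ⟨h1, h2, h3⟩
    exact h S ((P.clo_iff h2).2 h3) (Set.subset_union_left.trans h1)
      (Set.range_subset_iff.1 (Set.subset_union_right.trans h1))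

end concrete

/-- **Predimension and pregeometry** (Lemma `predimpregeo`): for D₁ ◁ D and D₂ a finitely
generated extension of D₁ inside D, we have D₂ ◁ D iff K-td(D₂/D₁) = δ(D₂/D₁); moreover
K-td(D₂/D₁) is the minimum of δ(D'/D₁) over finitely generated D' with D₂ ⊆ D' ⊆ D. -/
theorem predim_pregeometry (P : PPF K) (D₁ D₂ : Submodule ℚ P.V)
    (h₁ : P.StrongExt D₁ P.D) (h12 : D₁ ≤ D₂) (h2D : D₂ ≤ P.D)
    (hfg : ∃ (m : ℕ) (b : Fin m → P.V), D₂ = D₁ ⊔ span ℚ (Set.range b)) :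
    (P.StrongExt D₂ P.D ↔
      (P.ktdIn P.D (D₂ : Set P.V) (D₁ : Set P.V) : ℤ) = P.delta (D₂ : Set P.V) (D₁ : Set P.V)) ∧
    (P.ktdIn P.D (D₂ : Set P.V) (D₁ : Set P.V) : ℤ) =
      sInf {m : ℤ | ∃ D' : Submodule ℚ P.V, D₂ ≤ D' ∧ D' ≤ P.D ∧
        (∃ (k : ℕ) (b : Fin k → P.V), D' = D₁ ⊔ span ℚ (Set.range b)) ∧
        m = P.delta (D' : Set P.V) (D₁ : Set P.V)} := by
  have hp := P.predim
  have hX := (P.str_iff (h12.trans h2D)).2 h₁.2.2.2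
  have hXZ : FGo D₁ D₂ := FGo_iff.2 hfg
  obtain ⟨E, hE, hZE, hXE, hEs, hmin, hk⟩ := hp.main hX h2D hXZ
  rw [← P.ktd_eq] at hk
  rw [hk]
  refine ⟨?_, ?_⟩
  · constructor
    · intro hs
      have hs' := (P.str_iff h2D).2 hs.2.2.2
      have e1 := hp.add hE h12 hZE hXE
      have e2 := hs'.2 E hE (hXE.upper h12 hZE)
      have e3 := hmin D₂ h2D le_rfl hXZ
      simp only at e1 e2 e3 ⊢
      omega
    · intro he
      refine ⟨h2D, le_rfl, fun x hx h1 => h12 (h₁.2.2.1 x hx h1), ?_⟩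
      rw [← P.str_iff h2D]
      refine ⟨h2D, fun W hW hZW => ?_⟩
      have e1 := hp.add hW h12 hZW.le (hXZ.trans hZW)
      have e2 := hmin W hW hZW.le (hXZ.trans hZW)
      simp only at e1 e2 he ⊢
      omega
  · symm
    apply IsLeast.csInf_eq
    refine ⟨⟨E, hZE, hE, FGo_iff.1 hXE, rfl⟩, ?_⟩
    rintro m ⟨D', h1, h2, h3, rfl⟩
    exact hmin D' h2 h1 (FGo_iff.2 h3)
end
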